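/- arXiv:1108.0065 — 5 statements merged into one kernel-verified Lean document; each statement's English description precedes it below -/
import Mathlib

section
/- Let p be an n×n real matrix with nonnegative entries and perm(p) > 0. Then the Bethe approximation lower-bounds the permanent: perm(p) ≥ Z_{o-BP}(p), where Z_{o-BP}(p) = exp(−min_{β∈𝓑_p} F_BP(β|p)). -/
open scoped BigOperators

/-- The permanent of an `n × n` real matrix. -/
noncomputable def permanent {n : ℕ} (p : Matrix (Fin n) (Fin n) ℝ) : ℝ :=
  ∑ σ : Equiv.Perm (Fin n), ∏ i, p i (σ i)

/-- A matrix is doubly stochastic: nonnegative entries, all row and column sums equal 1. -/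
def DoublyStochastic {n : ℕ} (β : Matrix (Fin n) (Fin n) ℝ) : Prop :=
  (∀ i j, 0 ≤ β i j) ∧ (∀ i, ∑ j, β i j = 1) ∧ (∀ j, ∑ i, β i j = 1)

/-- Membership in the β-polytope `𝓑_p` of `p`. -/
def InPolytope {n : ℕ} (p β : Matrix (Fin n) (Fin n) ℝ) : Prop :=
  DoublyStochastic β ∧ ∀ i j, p i j = 0 → β i j = 0

/-- Membership in the interior of the β-polytope of `p`. -/
def InInterior {n : ℕ} (p β : Matrix (Fin n) (Fin n) ℝ) : Prop :=
  InPolytope p β ∧ ∀ i j, 0 < p i j → 0 < β i j ∧ β i j < 1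

/-- Bethe free energy `F_BP(β|p)` (sum over entries with `p i j > 0`;
the convention `0 * log 0 = 0` holds since `Real.log 0 = 0`). -/
noncomputable def FBP {n : ℕ} (p β : Matrix (Fin n) (Fin n) ℝ) : ℝ :=
  ∑ i, ∑ j, if 0 < p i j then
    β i j * Real.log (β i j / p i j) - (1 - β i j) * Real.log (1 - β i j)
  else 0

/-- Mean-field free energy `F_MF(β|p)`. -/
noncomputable def FMF {n : ℕ} (p β : Matrix (Fin n) (Fin n) ℝ) : ℝ :=
  ∑ i, ∑ j, if 0 < p i j then
    β i j * Real.log (β i j / p i j) + (1 - β i j) * Real.log (1 - β i j)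
  else 0

/-- Fractional free energy `F_f^γ(β|p)`. -/
noncomputable def Ff {n : ℕ} (γ : ℝ) (p β : Matrix (Fin n) (Fin n) ℝ) : ℝ :=
  ∑ i, ∑ j, if 0 < p i j then
    β i j * Real.log (β i j / p i j) + γ * ((1 - β i j) * Real.log (1 - β i j))
  else 0

/-- Optimal fractional partition function `Z_of^γ(p) = exp(-min_{β ∈ 𝓑_p} F_f^γ(β|p))`
(the minimum is expressed as an infimum; it is attained since `𝓑_p` is nonempty and
compact when `permanent p > 0` and `F_f^γ(·|p)` is continuous on it). -/
noncomputable def Zof {n : ℕ} (γ : ℝ) (p : Matrix (Fin n) (Fin n) ℝ) : ℝ :=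
  Real.exp (-(sInf ((fun β => Ff γ p β) '' {β | InPolytope p β})))

section Aux
variable {ι : Type} [DecidableEq ι]

/-- Monomer-dimer partition function, by deletion-contraction over a list of edges. -/
noncomputable def mdZ (w : ι × ι → ℝ) (x : ι ⊕ ι → ℝ) : List (ι × ι) → Finset (ι ⊕ ι) → ℝ
  | [], S => ∏ v ∈ S, x v
  | e :: L, S => mdZ w x L S +
      if Sum.inl e.1 ∈ S ∧ Sum.inr e.2 ∈ S then
        w e * mdZ w x L ((S.erase (Sum.inl e.1)).erase (Sum.inr e.2)) else 0

/-- Accumulated symmetric weight between two vertices. -/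
noncomputable def mdW (w : ι × ι → ℝ) : List (ι × ι) → ι ⊕ ι → ι ⊕ ι → ℝ
  | [], _, _ => 0
  | e :: L, v, k => mdW w L v k +
      if (Sum.inl e.1 = v ∧ Sum.inr e.2 = k) ∨ (Sum.inl e.1 = k ∧ Sum.inr e.2 = v) then w e else 0

lemma mdW_nonneg (w : ι × ι → ℝ) (hw : ∀ e, 0 ≤ w e) (L) (v k : ι ⊕ ι) : 0 ≤ mdW w L v k := by
  induction L with
  | nil => simp [mdW]
  | cons e L ih =>
    simp only [mdW]
    have := hw e
    split_ifs <;> linarith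

lemma mdW_same (w : ι × ι → ℝ) (L) (v k : ι ⊕ ι) (h : v.isLeft = k.isLeft) : mdW w L v k = 0 := by
  induction L with
  | nil => simp [mdW]
  | cons e L ih =>
    simp only [mdW, ih]
    rw [if_neg]; · simp
    rintro (⟨rfl, rfl⟩ | ⟨rfl, rfl⟩) <;> simp at h

lemma mdW_not_mem (w : ι × ι → ℝ) (L) (i j : ι) (h : (i, j) ∉ L) :
    mdW w L (Sum.inl i) (Sum.inr j) = 0 := by
  induction L with
  | nil => simp [mdW]
  | cons e L ih =>
    simp only [List.mem_cons, not_or] at h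
    simp only [mdW, ih h.2]
    rw [if_neg]; · simp
    rintro (⟨h1, h2⟩ | ⟨h1, h2⟩)
    · simp at h1 h2; exact h.1 (by ext <;> simp [h1, h2])
    · simp at h1

lemma mdW_mem (w : ι × ι → ℝ) (L) (hL : L.Nodup) (i j : ι) (h : (i, j) ∈ L) :
    mdW w L (Sum.inl i) (Sum.inr j) = w (i, j) := by
  induction L with
  | nil => simp at h
  | cons e L ih =>
    rw [List.nodup_cons] at hL
    simp only [mdW]
    by_cases he : e = (i, j)
    · subst he
      rw [mdW_not_mem _ _ _ _ hL.1]; simp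
    · have : (i, j) ∈ L := by
        rcases List.mem_cons.1 h with h | h
        · exact absurd h.symm he
        · exact h
      rw [ih hL.2 this, if_neg]; · simp
      rintro (⟨h1, h2⟩ | ⟨h1, h2⟩)
      · simp at h1 h2; exact he (by ext <;> simp [h1, h2])
      · simp at h1

lemma mdZ_nonneg (w : ι × ι → ℝ) (hw : ∀ e, 0 ≤ w e) (x : ι ⊕ ι → ℝ) (hx : ∀ v, 0 ≤ x v) (L) (S) :
    0 ≤ mdZ w x L S := by
  induction L generalizing S with
  | nil => exact Finset.prod_nonneg fun v _ => hx v
  | cons e L ih =>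
    simp only [mdZ]
    have := mul_nonneg (hw e) (ih ((S.erase (Sum.inl e.1)).erase (Sum.inr e.2)))
    have := ih S
    split_ifs <;> linarith

lemma mdZ_congr (w : ι × ι → ℝ) (x y : ι ⊕ ι → ℝ) (L) (S) (h : ∀ v ∈ S, x v = y v) :
    mdZ w x L S = mdZ w y L S := by
  induction L generalizing S with
  | nil => exact Finset.prod_congr rfl h
  | cons e L ih =>
    simp only [mdZ]
    rw [ih S h, ih _ (fun v hv => h v (Finset.mem_of_mem_erase (Finset.mem_of_mem_erase hv)))]

lemma mdZ_expand (w : ι × ι → ℝ) (x : ι ⊕ ι → ℝ) (L) (S : Finset (ι ⊕ ι)) (v) (hv : v ∈ S) :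
    mdZ w x L S = x v * mdZ w x L (S.erase v) +
      ∑ k ∈ S.erase v, mdW w L v k * mdZ w x L ((S.erase v).erase k) := by
  induction L generalizing S with
  | nil => simp [mdZ, mdW, Finset.mul_prod_erase _ _ hv]
  | cons e L ih =>
    obtain ⟨i, j⟩ := e
    simp only [mdZ, mdW]
    by_cases h1 : Sum.inl i = v
    · subst h1
      rw [ih S hv]
      simp only [Finset.mem_erase, ne_eq, not_true_eq_false, false_and, and_false, if_false,
        add_zero, add_mul, Finset.sum_add_distrib, true_and, reduceCtorEq, or_false, hv, ite_mul,
        zero_mul, Finset.sum_ite_eq, not_false_eq_true]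
      ring
    by_cases h2 : Sum.inr j = v
    · subst h2
      rw [ih S hv]
      simp only [Finset.mem_erase, ne_eq, not_true_eq_false, false_and, and_false, if_false,
        add_zero, add_mul, Finset.sum_add_distrib, and_true, reduceCtorEq, false_or, hv, ite_mul,
        zero_mul, Finset.sum_ite_eq, not_false_eq_true, true_and]
      rw [Finset.erase_right_comm]
      ring
    simp only [h1, h2, false_and, and_false, or_false, if_false, add_zero]
    by_cases hab : Sum.inl i ∈ S ∧ Sum.inr j ∈ S
    · rw [if_pos hab, ih S hv, ih ((S.erase (Sum.inl i)).erase (Sum.inr j))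
        (by simp [hv, Ne.symm h1, Ne.symm h2])]
      rw [if_pos (by simp [hab, h1, h2])]
      have e1 : ((S.erase (Sum.inl i)).erase (Sum.inr j)).erase v =
        ((S.erase v).erase (Sum.inl i)).erase (Sum.inr j) := by
        ext; simp; tauto
      rw [e1]
      have : ∑ k ∈ S.erase v, mdW w L v k * (mdZ w x L ((S.erase v).erase k) +
          if Sum.inl i ∈ (S.erase v).erase k ∧ Sum.inr j ∈ (S.erase v).erase k then
            w (i, j) * mdZ w x L ((((S.erase v).erase k).erase (Sum.inl i)).erase (Sum.inr j)) else 0)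
          = ∑ k ∈ S.erase v, mdW w L v k * mdZ w x L ((S.erase v).erase k) +
           w (i, j) * ∑ k ∈ ((S.erase v).erase (Sum.inl i)).erase (Sum.inr j),
            mdW w L v k * mdZ w x L ((((S.erase v).erase (Sum.inl i)).erase (Sum.inr j)).erase k) := by
        simp only [mul_add, Finset.sum_add_distrib, Finset.mul_sum]
        congr 1
        symm
        apply Finset.sum_subset_zero_on_sdiff
        · intro k; simp
        · intro k hk
          rw [if_neg, mul_zero]
          simp at hk ⊢; grind
        · intro k hk
          rw [if_pos]
          · rw [show (((S.erase v).erase k).erase (Sum.inl i)).erase (Sum.inr j) =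
              (((S.erase v).erase (Sum.inl i)).erase (Sum.inr j)).erase k by ext; simp; tauto]
            ring
          · simp at hk ⊢; grind
      rw [this]; ring
    · rw [if_neg hab, ih S hv, if_neg (by simp; grind)]
      simp only [add_zero]
      congr 1
      apply Finset.sum_congr rfl
      intro k hk
      rw [if_neg (by simp; grind), add_zero]

/-- Rayleigh-type correlation inequalities (Heilmann and Lieb) for bipartite monomer-dimer systems. -/
lemma mdZ_rayleigh (w : ι × ι → ℝ) (hw : ∀ e, 0 ≤ w e) (x : ι ⊕ ι → ℝ) (L)
    (N : ℕ) : ∀ (S : Finset (ι ⊕ ι)), S.card = N → ∀ i ∈ S, ∀ j ∈ S, i ≠ j →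
    0 ≤ (if i.isLeft = j.isLeft then (1:ℝ) else -1) *
      (mdZ w x L (S.erase i) * mdZ w x L (S.erase j)
        - mdZ w x L S * mdZ w x L ((S.erase i).erase j)) := by
  induction N with
  | zero =>
    intro S hS i hi
    rw [Finset.card_eq_zero] at hS; simp [hS] at hi
  | succ N ih =>
    intro S hS i hi j hj hij
    have ih' := ih (S.erase i) (by rw [Finset.card_erase_of_mem hi, hS]; rfl)
    set F := mdZ w x L with hF
    have E1 := mdZ_expand w x L S i hi
    have E2 := mdZ_expand w x L (S.erase j) i (by simp [hi, hij])
    rw [← hF] at E1 E2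
    rw [Finset.erase_right_comm] at E2
    have hj' : j ∈ S.erase i := by simp [hj, hij.symm]
    rw [← Finset.add_sum_erase _ _ hj'] at E1
    have key : (if i.isLeft = j.isLeft then (1:ℝ) else -1) *
      (F (S.erase i) * F (S.erase j) - F S * F ((S.erase i).erase j)) =
      (if i.isLeft = j.isLeft then (1:ℝ) else -1) * (- mdW w L i j * F ((S.erase i).erase j) ^ 2) +
      ∑ k ∈ (S.erase i).erase j, mdW w L i k *
       ((if i.isLeft = j.isLeft then (1:ℝ) else -1) * (F (S.erase i) * F (((S.erase i).erase j).erase k)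
         - F ((S.erase i).erase k) * F ((S.erase i).erase j))) := by
      rw [E1, E2]
      have : ∑ k ∈ (S.erase i).erase j, mdW w L i k *
       ((if i.isLeft = j.isLeft then (1:ℝ) else -1) * (F (S.erase i) * F (((S.erase i).erase j).erase k)
         - F ((S.erase i).erase k) * F ((S.erase i).erase j))) =
        (if i.isLeft = j.isLeft then (1:ℝ) else -1) *
        (F (S.erase i) * ∑ k ∈ (S.erase i).erase j, mdW w L i k * F (((S.erase i).erase j).erase k)
        - (∑ k ∈ (S.erase i).erase j, mdW w L i k * F ((S.erase i).erase k)) *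
           F ((S.erase i).erase j)) := by
        rw [Finset.mul_sum, Finset.sum_mul, ← Finset.sum_sub_distrib, Finset.mul_sum]
        apply Finset.sum_congr rfl
        intros; ring
      rw [this]; ring
    rw [key]
    apply add_nonneg
    · split_ifs with h
      · rw [mdW_same _ _ _ _ h]; simp
      · have := mul_nonneg (mdW_nonneg w hw L i j) (sq_nonneg (F ((S.erase i).erase j)))
        linarith
    · apply Finset.sum_nonneg
      intro k hk
      by_cases hik : i.isLeft = k.isLeft
      · rw [mdW_same _ _ _ _ hik]; simp
      apply mul_nonneg (mdW_nonneg w hw L i k)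
      simp only [Finset.mem_erase] at hk
      have := ih' j hj' k (by simp [hk]) (Ne.symm hk.1)
      by_cases hij' : i.isLeft = j.isLeft
      · have hjk : ¬ j.isLeft = k.isLeft := by rw [← hij']; exact hik
        rw [if_neg hjk] at this
        rw [if_pos hij']; linarith
      · have hjk : j.isLeft = k.isLeft := by
          revert hik hij'
          cases i.isLeft <;> cases j.isLeft <;> cases k.isLeft <;> simp
        rw [if_pos hjk] at this
        rw [if_neg hij']; linarith

lemma mdZ_update (w : ι × ι → ℝ) (x : ι ⊕ ι → ℝ) (L) (S : Finset (ι ⊕ ι)) (v) (hv : v ∈ S) (t : ℝ) :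
    mdZ w (Function.update x v (x v + t)) L S = mdZ w x L S + t * mdZ w x L (S.erase v) := by
  rw [mdZ_expand w _ L S v hv, mdZ_expand w x L S v hv]
  have hc : ∀ T : Finset (ι ⊕ ι), v ∉ T →
      mdZ w (Function.update x v (x v + t)) L T = mdZ w x L T := fun T hT =>
    mdZ_congr w _ _ L T fun u hu => Function.update_of_ne (by rintro rfl; exact hT hu) _ _
  rw [hc _ (by simp), Finset.sum_congr rfl (fun k _ => by rw [hc ((S.erase v).erase k) (by simp)])]
  simp; ring

variable [Fintype ι]

lemma mdZ_perm_aux (w : ι × ι → ℝ) (L : List (ι × ι)) (hL : L.Nodup) (hall : ∀ e, e ∈ L)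
    (N : ℕ) : ∀ (D : Finset ι) (g : ι → ι), Dᶜ.card = N → Set.InjOn g D →
    (∏ i ∈ D, w (i, g i)) * mdZ w 0 L (Dᶜ.disjSum (D.image g)ᶜ) =
    ∑ σ : Equiv.Perm ι, if ∀ i ∈ D, σ i = g i then ∏ i, w (i, σ i) else 0 := by
  induction N with
  | zero =>
    intro D g hD hg
    rw [Finset.card_eq_zero, Finset.compl_eq_empty_iff] at hD
    subst hD
    have hg' : Function.Injective g := fun a b h => hg (by simp) (by simp) h
    have hb : Function.Bijective g := Finite.injective_iff_bijective.1 hg'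
    rw [Finset.sum_eq_single (Equiv.ofBijective g hb)]
    · have : (Finset.univ : Finset ι)ᶜ.disjSum (Finset.univ.image g)ᶜ = ∅ := by
        rw [Finset.image_univ_of_surjective hb.2]; simp
      rw [this]
      have hz : ∀ L : List (ι × ι), mdZ w 0 L ∅ = 1 := by
        intro L; induction L with
        | nil => simp [mdZ]
        | cons e L ih => simp [mdZ, ih]
      rw [hz]; simp
    · intro σ _ hσ
      rw [if_neg]
      intro h; exact hσ (by ext i; simpa using h i (by simp))
    · simp
  | succ N ih =>
    intro D g hD hg
    obtain ⟨i, hi⟩ : Dᶜ.Nonempty := by rw [← Finset.card_pos]; omega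
    have hi' : i ∉ D := by simpa using hi
    rw [mdZ_expand w 0 L _ (Sum.inl i) (by simp [hi'])]
    simp only [Pi.zero_apply, zero_mul, zero_add]
    have her : (Dᶜ.disjSum (D.image g)ᶜ).erase (Sum.inl i) =
        (Dᶜ.erase i).disjSum (D.image g)ᶜ := by
      ext v; rcases v with a | b <;> simp
    rw [her, Finset.sum_disjSum, Finset.sum_eq_zero, zero_add]
    swap
    · intro k _
      rw [mdW_same _ _ _ _ (by simp)]; simp
    rw [Finset.mul_sum]
    have hR : ∀ σ : Equiv.Perm ι, (if ∀ i ∈ D, σ i = g i then ∏ i, w (i, σ i) else 0) =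
       ∑ k, if (∀ i ∈ D, σ i = g i) ∧ σ i = k then ∏ i, w (i, σ i) else 0 := by
      intro σ
      by_cases h : ∀ i ∈ D, σ i = g i
      · rw [if_pos h, Finset.sum_eq_single (σ i)]
        · rw [if_pos ⟨h, rfl⟩]
        · intro k _ hk
          rw [if_neg fun h' => hk h'.2.symm]
        · simp
      · rw [if_neg h, Finset.sum_eq_zero]
        intro k _
        rw [if_neg fun h' => h h'.1]
    rw [Finset.sum_congr rfl (fun σ _ => hR σ), Finset.sum_comm]
    apply Finset.sum_subset_zero_on_sdiff (Finset.subset_univ _)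
    · intro k hk
      simp only [Finset.mem_sdiff, Finset.mem_univ, true_and, Finset.mem_compl, not_not,
        Finset.mem_image] at hk
      obtain ⟨a, ha, hak⟩ := hk
      apply Finset.sum_eq_zero
      intro σ _
      rw [if_neg]
      rintro ⟨h1, h2⟩
      have : a = i := σ.injective (by rw [h1 a ha, hak, h2])
      exact hi' (this ▸ ha)
    · intro k hk
      rw [mdW_mem w L hL i k (hall _)]
      have hk : ∀ a ∈ D, g a ≠ k := by simpa using hk
      have hupd : ∀ a ∈ D, Function.update g i k a = g a := fun a ha =>
        Function.update_of_ne (by rintro rfl; exact hi' ha) _ _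
      have := ih (insert i D) (Function.update g i k) (by
          rw [Finset.compl_insert, Finset.card_erase_of_mem hi, hD]; rfl) (by
          intro a ha b hb hab
          simp only [Finset.coe_insert, Set.mem_insert_iff, Finset.mem_coe] at ha hb
          rcases ha with rfl | ha <;> rcases hb with rfl | hb
          · rfl
          · rw [hupd b hb] at hab; simp at hab; exact absurd hab.symm (hk b hb)
          · rw [hupd a ha] at hab; simp at hab; exact absurd hab (hk a ha)
          · rw [hupd a ha, hupd b hb] at hab; exact hg ha hb hab)
      rw [Finset.prod_insert hi', Finset.prod_congr rfl (fun a ha => by rw [hupd a ha])] at this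
      rw [Finset.image_insert, Finset.image_congr (fun a ha => hupd a ha)] at this
      simp only [Function.update_self] at this
      have hset : (insert i D)ᶜ.disjSum (insert k (D.image g))ᶜ =
          ((Dᶜ.erase i).disjSum (D.image g)ᶜ).erase (Sum.inr k) := by
        ext v
        rcases v with a | b <;> simp
      rw [hset] at this
      trans (w (i, k) * ∏ x ∈ D, w (x, g x)) * mdZ w 0 L
          (((Dᶜ.erase i).disjSum (D.image g)ᶜ).erase (Sum.inr k))
      · ring
      rw [this]
      apply Finset.sum_congr rfl
      intro σ _
      have : (∀ a ∈ insert i D, σ a = Function.update g i k a) ↔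
          ((∀ a ∈ D, σ a = g a) ∧ σ i = k) := by
        simp only [Finset.mem_insert, forall_eq_or_imp, Function.update_self]
        rw [and_comm]
        constructor
        · rintro ⟨h1, h2⟩; exact ⟨fun a ha => by rw [h1 a ha, hupd a ha], h2⟩
        · rintro ⟨h1, h2⟩; exact ⟨fun a ha => by rw [h1 a ha, hupd a ha], h2⟩
      simp only [this]

lemma mdZ_perm (w : ι × ι → ℝ) (L : List (ι × ι)) (hL : L.Nodup) (hall : ∀ e, e ∈ L) :
    mdZ w 0 L Finset.univ = ∑ σ : Equiv.Perm ι, ∏ i, w (i, σ i) := by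
  have := mdZ_perm_aux w L hL hall _ ∅ id rfl (by simp)
  simp only [Finset.prod_empty, one_mul, Finset.notMem_empty, false_imp_iff,
    implies_true, if_true] at this
  rw [← this]; congr 1
  ext v; rcases v with a | b <;> simp

lemma edge_pos (a b c d C α : ℝ) (ha : 0 < a) (hb : 0 < b) (hc : 0 < c) (hd : 0 < d)
    (h : a * d = b * c) (h0 : 0 < α) (h1 : α < 1)
    (hC : ∀ s t : ℝ, 0 < s → 0 < t → C * (s * t) ^ α ≤ a + b * s + c * t + d * (s * t)) :
    C * (α ^ α * (1 - α) ^ (1 - α)) ≤ a + d := by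
  have h1' : 0 < 1 - α := by linarith
  have key := hC (a * α / (b * (1 - α))) (a * α / (c * (1 - α))) (by positivity) (by positivity)
  have hst : a * α / (b * (1 - α)) * (a * α / (c * (1 - α))) = a * α ^ 2 / (d * (1 - α) ^ 2) := by
    rw [div_mul_div_comm, div_eq_div_iff (by positivity) (by positivity)]
    linear_combination (a * α ^ 2 * (1 - α) ^ 2) * h
  rw [hst] at key
  have hv : a + b * (a * α / (b * (1 - α))) + c * (a * α / (c * (1 - α)))
      + d * (a * α ^ 2 / (d * (1 - α) ^ 2)) = a / (1 - α) ^ 2 := by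
    field_simp; ring
  rw [hv] at key
  have hamgm := Real.geom_mean_le_arith_mean2_weighted h1'.le h0.le
    (div_pos ha h1').le (div_pos hd h0).le (by ring)
  have e1 : (1 - α) * (a / (1 - α)) + α * (d / α) = a + d := by field_simp
  rw [e1] at hamgm
  refine le_trans ?_ hamgm
  have hX : 0 < (a * α ^ 2 / (d * (1 - α) ^ 2)) ^ α := by positivity
  rw [← le_div_iff₀ hX] at key
  refine (mul_le_mul_of_nonneg_right key (by positivity)).trans (le_of_eq ?_)
  apply Real.log_injOn_pos (Set.mem_Ioi.2 (by positivity)) (Set.mem_Ioi.2 (by positivity))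
  rw [Real.log_mul (by positivity) (by positivity), Real.log_mul (by positivity) (by positivity),
    Real.log_div (by positivity) (by positivity), Real.log_div (by positivity) (by positivity),
    Real.log_mul (by positivity) (by positivity)]
  rw [Real.log_rpow (by positivity), Real.log_rpow (by positivity), Real.log_rpow (by positivity),
    Real.log_rpow (by positivity), Real.log_rpow (by positivity)]
  rw [Real.log_div (by positivity) (by positivity), Real.log_div (by positivity) (by positivity),
    Real.log_div (by positivity) (by positivity), Real.log_mul (by positivity) (by positivity),
    Real.log_mul (by positivity) (by positivity), Real.log_pow, Real.log_pow]
  push_cast; ring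

lemma edge_pos' (a b c d C α : ℝ) (ha : 0 < a) (hb : 0 ≤ b) (hc : 0 ≤ c) (hd : 0 < d)
    (h : b * c ≤ a * d) (h0 : 0 < α) (h1 : α < 1)
    (hC : ∀ s t : ℝ, 0 < s → 0 < t → C * (s * t) ^ α ≤ a + b * s + c * t + d * (s * t)) :
    C * (α ^ α * (1 - α) ^ (1 - α)) ≤ a + d := by
  obtain ⟨b', c', hb', hc', hbb, hcc, he⟩ : ∃ b' c' : ℝ, 0 < b' ∧ 0 < c' ∧ b ≤ b' ∧ c ≤ c' ∧
      a * d = b' * c' := by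
    rcases hb.lt_or_eq with hb | hb
    · exact ⟨b, a * d / b, hb, by positivity, le_rfl, by rw [le_div_iff₀ hb]; linarith, by field_simp⟩
    · rcases hc.lt_or_eq with hc | hc
      · exact ⟨a * d / c, c, by positivity, hc, by rw [← hb]; positivity, le_rfl, by field_simp⟩
      · exact ⟨a * d, 1, by positivity, one_pos, by rw [← hb]; positivity, by rw [← hc]; simp, by simp⟩
  refine edge_pos a b' c' d C α ha hb' hc' hd he h0 h1 fun s t hs ht => (hC s t hs ht).trans ?_
  have := mul_le_mul_of_nonneg_right hbb hs.le
  have := mul_le_mul_of_nonneg_right hcc ht.le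
  linarith

lemma le_of_eps (X : ℝ) (f : ℝ → ℝ) (hf : Continuous f) (h : ∀ ε > 0, X ≤ f ε) : X ≤ f 0 := by
  have ht : Filter.Tendsto f (nhdsWithin 0 (Set.Ioi 0)) (nhds (f 0)) :=
    (hf.tendsto 0).mono_left nhdsWithin_le_nhds
  exact ge_of_tendsto ht (Filter.eventually_of_mem self_mem_nhdsWithin fun ε hε => h ε hε)

lemma edge_ineq (a b c d C α : ℝ) (ha : 0 ≤ a) (hb : 0 ≤ b) (hc : 0 ≤ c) (hd : 0 ≤ d)
    (h : b * c ≤ a * d) (h0 : 0 ≤ α) (h1 : α ≤ 1)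
    (hC : ∀ s t : ℝ, 0 < s → 0 < t → C * (s * t) ^ α ≤ a + b * s + c * t + d * (s * t)) :
    C * (α ^ α * (1 - α) ^ (1 - α)) ≤ a + d := by
  rcases h0.lt_or_eq with h0 | h0
  · rcases h1.lt_or_eq with h1 | h1
    · have := le_of_eps (C * (α ^ α * (1 - α) ^ (1 - α))) (fun ε => (a + ε) + (d + ε))
        (by fun_prop) (fun ε hε => by
          refine edge_pos' (a + ε) b c (d + ε) C α (by linarith) hb hc (by linarith) ?_ h0 h1 ?_
          · nlinarith [mul_nonneg ha (le_of_lt hε), mul_nonneg hd (le_of_lt hε)]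
          · intro s t hs ht
            have := hC s t hs ht
            have : 0 < ε * (s * t) := by positivity
            have : 0 < ε := hε
            nlinarith)
      simpa using this
    · subst h1
      have := le_of_eps C (fun ε => a * ε ^ 2 + b * ε + c * ε + d) (by fun_prop) (fun ε hε => by
        have hε : 0 < ε := hε
        have := hC (1 / ε) (1 / ε) (by positivity) (by positivity)
        rw [Real.rpow_one] at this
        have h2 := mul_le_mul_of_nonneg_right this (sq_nonneg ε)
        have e1 : C * (1 / ε * (1 / ε)) * ε ^ 2 = C := by field_simp
        rw [e1] at h2
        refine h2.trans (le_of_eq ?_)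
        field_simp)
      simp at this
      simp; linarith
  · subst h0
    have := le_of_eps C (fun ε => a + b * ε + c * ε + d * (ε * ε)) (by fun_prop) (fun ε hε => by
      simpa using hC ε ε hε hε)
    simp at this
    simp; linarith

/-- Vertex weights after the edges of `L` have been contracted. -/
noncomputable def vw (p : ι × ι → ℝ) (L : List (ι × ι)) (y z : ι × ι → ℝ) : ι ⊕ ι → ℝ :=
  Sum.elim (fun i => ∑ j, if (i, j) ∈ L then 0 else p (i, j) * y (i, j))
    (fun j => ∑ i, if (i, j) ∈ L then 0 else z (i, j))

lemma vw_nonneg (p : ι × ι → ℝ) (hp : ∀ e, 0 ≤ p e) (L : List (ι × ι)) (y z : ι × ι → ℝ)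
    (hy : ∀ e, 0 < y e) (hz : ∀ e, 0 < z e) (v) : 0 ≤ vw p L y z v := by
  rcases v with i | j
  · simp only [vw, Sum.elim_inl]
    refine Finset.sum_nonneg fun j _ => ?_
    split_ifs
    · exact le_rfl
    · exact mul_nonneg (hp _) (hy _).le
  · simp only [vw, Sum.elim_inr]
    refine Finset.sum_nonneg fun j _ => ?_
    split_ifs
    · exact le_rfl
    · exact (hz _).le

lemma vw_cons (p : ι × ι → ℝ) (L : List (ι × ι)) (i j : ι) (he : (i, j) ∉ L) (y z : ι × ι → ℝ)
    (s t : ℝ) : vw p L (Function.update y (i, j) s) (Function.update z (i, j) t) =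
      Function.update (Function.update (vw p ((i, j) :: L) y z) (Sum.inl i)
        (vw p ((i, j) :: L) y z (Sum.inl i) + p (i, j) * s)) (Sum.inr j)
        (Function.update (vw p ((i, j) :: L) y z) (Sum.inl i)
        (vw p ((i, j) :: L) y z (Sum.inl i) + p (i, j) * s) (Sum.inr j) + t) := by
  funext v
  rcases v with a | b
  · rw [Function.update_of_ne (by simp)]
    by_cases ha : a = i
    · subst ha
      rw [Function.update_self]
      simp only [vw, Sum.elim_inl]
      rw [← Finset.sum_erase_add _ _ (Finset.mem_univ j),
        ← Finset.sum_erase_add _ (fun k => if (a, k) ∈ (a, j) :: L then 0 else p (a, k) * y (a, k))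
          (Finset.mem_univ j)]
      simp only [he, if_false, Function.update_self, List.mem_cons, true_or, if_true, add_zero]
      congr 1
      apply Finset.sum_congr rfl
      intro k hk
      have hk : k ≠ j := by simpa using hk
      simp [hk]
    · rw [Function.update_of_ne (by simpa using ha)]
      simp [vw, ha]
  · by_cases hb : b = j
    · subst hb
      rw [Function.update_self, Function.update_of_ne (by simp)]
      simp only [vw, Sum.elim_inr]
      rw [← Finset.sum_erase_add _ _ (Finset.mem_univ i),
        ← Finset.sum_erase_add _ (fun k => if (k, b) ∈ (i, b) :: L then 0 else z (k, b))
          (Finset.mem_univ i)]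
      simp only [he, if_false, Function.update_self, List.mem_cons, true_or, if_true, add_zero]
      congr 1
      apply Finset.sum_congr rfl
      intro k hk
      have hk : k ≠ i := by simpa using hk
      simp [hk]
    · rw [Function.update_of_ne (by simpa using hb), Function.update_of_ne (by simp)]
      simp [vw, hb]

lemma main_step (p β : ι × ι → ℝ) (hp : ∀ e, 0 ≤ p e) (h0 : ∀ e, 0 ≤ β e) (h1 : ∀ e, β e ≤ 1)
    (C : ℝ)
    (hbase : ∀ y z : ι × ι → ℝ, (∀ e, 0 < y e) → (∀ e, 0 < z e) →
      C * ∏ e, (y e * z e) ^ β e ≤ mdZ p (vw p [] y z) [] Finset.univ)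
    (L : List (ι × ι)) (hL : L.Nodup) :
    ∀ y z : ι × ι → ℝ, (∀ e, 0 < y e) → (∀ e, 0 < z e) →
      (C * ∏ e ∈ L.toFinset, (β e ^ β e * (1 - β e) ^ (1 - β e))) *
        ∏ e ∈ L.toFinsetᶜ, (y e * z e) ^ β e ≤ mdZ p (vw p L y z) L Finset.univ := by
  induction L with
  | nil => simpa using hbase
  | cons e L ih =>
    obtain ⟨i, j⟩ := e
    rw [List.nodup_cons] at hL
    intro y z hy hz
    have ih := ih hL.2
    have heL : (i, j) ∉ L.toFinset := by simpa using hL.1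
    have hsplit : ∀ f : ι × ι → ℝ, ∏ e ∈ L.toFinsetᶜ, f e =
        f (i, j) * ∏ e ∈ ((i, j) :: L).toFinsetᶜ, f e := by
      intro f
      rw [List.toFinset_cons, Finset.compl_insert, Finset.mul_prod_erase _ _ (by simpa using heL)]
    set x := vw p ((i, j) :: L) y z with hx
    have hx0 : ∀ v, 0 ≤ x v := vw_nonneg p hp _ y z hy hz
    have ray := mdZ_rayleigh p hp x L _ Finset.univ rfl (Sum.inl i) (by simp) (Sum.inr j) (by simp)
      (by simp)
    simp only [Sum.isLeft_inl, Sum.isLeft_inr, Bool.true_eq_false, if_false] at ray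
    have Znn := fun S => mdZ_nonneg p hp x hx0 L S
    have key := edge_ineq (mdZ p x L Finset.univ) (p (i, j) * mdZ p x L (Finset.univ.erase (Sum.inl i)))
      (mdZ p x L (Finset.univ.erase (Sum.inr j)))
      (p (i, j) * mdZ p x L ((Finset.univ.erase (Sum.inl i)).erase (Sum.inr j)))
      ((C * ∏ e ∈ L.toFinset, (β e ^ β e * (1 - β e) ^ (1 - β e))) *
        ∏ e ∈ ((i, j) :: L).toFinsetᶜ, (y e * z e) ^ β e) (β (i, j))
      (Znn _) (mul_nonneg (hp _) (Znn _)) (Znn _) (mul_nonneg (hp _) (Znn _))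
      (by nlinarith [hp (i, j)]) (h0 _) (h1 _) (by
        intro s t hs ht
        have hI := ih (Function.update y (i, j) s) (Function.update z (i, j) t)
          (by intro e; by_cases h : e = (i, j)
              · subst h; simpa using hs
              · rw [Function.update_of_ne h]; exact hy e)
          (by intro e; by_cases h : e = (i, j)
              · subst h; simpa using ht
              · rw [Function.update_of_ne h]; exact hz e)
        rw [vw_cons p L i j hL.1, ← hx, mdZ_update _ _ _ _ _ (by simp),
          mdZ_update _ _ _ _ _ (by simp), mdZ_update _ _ _ _ _ (by simp),
          hsplit] at hI
        simp only [Function.update_self] at hI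
        have hcg : ∏ e ∈ ((i, j) :: L).toFinsetᶜ,
            (Function.update y (i, j) s e * Function.update z (i, j) t e) ^ β e =
            ∏ e ∈ ((i, j) :: L).toFinsetᶜ, (y e * z e) ^ β e := by
          apply Finset.prod_congr rfl
          intro e he
          have : e ≠ (i, j) := by rintro rfl; simp at he
          simp only [Function.update_of_ne this]
        rw [hcg] at hI
        rw [Finset.erase_right_comm] at hI
        refine le_trans (le_of_eq ?_) (hI.trans (le_of_eq ?_)) <;> ring)
    rw [List.toFinset_cons, Finset.prod_insert heL]
    rw [List.toFinset_cons] at key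
    simp only [mdZ, Finset.mem_univ, and_self, if_true]
    refine le_trans (le_of_eq ?_) key
    ring

lemma amgm_row (q b y : ι → ℝ) (hq : ∀ i, 0 ≤ q i) (hb : ∀ i, 0 ≤ b i) (hs : ∑ i, b i = 1)
    (hy : ∀ i, 0 < y i) :
    ∏ i, ((q i / b i) ^ b i * y i ^ b i) ≤ ∑ i, q i * y i := by
  have := Real.geom_mean_le_arith_mean_weighted Finset.univ b (fun i => q i / b i * y i)
    (fun i _ => hb i) hs (fun i _ => mul_nonneg (div_nonneg (hq i) (hb i)) (hy i).le)
  calc _ = ∏ i, (q i / b i * y i) ^ b i := by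
        apply Finset.prod_congr rfl; intro i _
        rw [Real.mul_rpow (div_nonneg (hq i) (hb i)) (hy i).le]
    _ ≤ _ := this
    _ ≤ _ := by
      apply Finset.sum_le_sum; intro i _
      rcases (hb i).lt_or_eq with h | h
      · apply le_of_eq; field_simp
      · rw [← h]; simpa using mul_nonneg (hq i) (hy i).le

lemma bethe_mul (p β : ι × ι → ℝ) (hp : ∀ e, 0 ≤ p e) (h0 : ∀ e, 0 ≤ β e)
    (hr : ∀ i, ∑ j, β (i, j) = 1) (hc : ∀ j, ∑ i, β (i, j) = 1) :
    ∏ e : ι × ι, ((p e / β e) ^ β e * (1 / β e) ^ β e * (β e ^ β e * (1 - β e) ^ (1 - β e))) ≤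
      ∑ σ : Equiv.Perm ι, ∏ i, p (i, σ i) := by
  have h1 : ∀ e, β e ≤ 1 := by
    rintro ⟨i, j⟩
    rw [← hr i]
    exact Finset.single_le_sum (f := fun j => β (i, j)) (fun j _ => h0 _) (Finset.mem_univ j)
  have hpos : ∀ e, 0 ≤ (p e / β e) ^ β e := fun e =>
    Real.rpow_nonneg (div_nonneg (hp e) (h0 e)) _
  have hpos' : ∀ e, 0 ≤ (1 / β e) ^ β e := fun e =>
    Real.rpow_nonneg (div_nonneg zero_le_one (h0 e)) _
  have key := main_step p β hp h0 h1 (∏ e : ι × ι, ((p e / β e) ^ β e * (1 / β e) ^ β e)) (by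
    intro y z hy hz
    simp only [mdZ, Fintype.prod_sum_type, vw, Sum.elim_inl, Sum.elim_inr, List.not_mem_nil,
      if_false]
    have A : ∏ e : ι × ι, ((p e / β e) ^ β e * y e ^ β e) ≤ ∏ i, ∑ j, p (i, j) * y (i, j) := by
      rw [Fintype.prod_prod_type]
      refine Finset.prod_le_prod (fun i _ => Finset.prod_nonneg fun j _ =>
        mul_nonneg (hpos _) (Real.rpow_nonneg (hy _).le _)) fun i _ => ?_
      exact amgm_row (fun j => p (i, j)) (fun j => β (i, j)) (fun j => y (i, j)) (fun _ => hp _)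
        (fun _ => h0 _) (hr i) (fun _ => hy _)
    have B : ∏ e : ι × ι, ((1 / β e) ^ β e * z e ^ β e) ≤ ∏ j, ∑ i, z (i, j) := by
      rw [Fintype.prod_prod_type_right]
      refine Finset.prod_le_prod (fun i _ => Finset.prod_nonneg fun j _ =>
        mul_nonneg (hpos' _) (Real.rpow_nonneg (hz _).le _)) fun j _ => ?_
      simpa using amgm_row (fun _ => 1) (fun i => β (i, j)) (fun i => z (i, j))
        (fun _ => zero_le_one) (fun _ => h0 _) (hc j) (fun _ => hz _)
    refine le_trans (le_of_eq ?_) (mul_le_mul A B (Finset.prod_nonneg fun e _ =>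
        mul_nonneg (hpos' _) (Real.rpow_nonneg (hz _).le _)) (Finset.prod_nonneg fun i _ =>
        Finset.sum_nonneg fun j _ => mul_nonneg (hp _) (hy _).le))
    rw [← Finset.prod_mul_distrib, ← Finset.prod_mul_distrib]
    apply Finset.prod_congr rfl
    intro e _
    rw [Real.mul_rpow (hy e).le (hz e).le]; ring)
    Finset.univ.toList (Finset.nodup_toList _) (fun _ => 1) (fun _ => 1) (by simp) (by simp)
  have hv : vw p Finset.univ.toList (fun _ => 1) (fun _ => 1) = 0 := by
    funext v; rcases v with i | j <;> simp [vw]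
  rw [hv, mdZ_perm p _ (Finset.nodup_toList _) (by simp)] at key
  refine le_trans (le_of_eq ?_) key
  simp [Finset.prod_mul_distrib]

end Aux

lemma FBP_ge {n : ℕ} (p β : Matrix (Fin n) (Fin n) ℝ)
    (hp : ∀ i j, 0 ≤ p i j) (hβ : InPolytope p β) : Real.exp (-FBP p β) ≤ permanent p := by
  obtain ⟨⟨h0, hr, hc⟩, hz⟩ := hβ
  refine le_trans (le_of_eq ?_) (bethe_mul (fun e => p e.1 e.2) (fun e => β e.1 e.2)
    (fun _ => hp _ _) (fun _ => h0 _ _) hr hc)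
  rw [Fintype.prod_prod_type, FBP, ← Finset.sum_neg_distrib, Real.exp_sum]
  apply Finset.prod_congr rfl; intro i _
  rw [← Finset.sum_neg_distrib, Real.exp_sum]
  apply Finset.prod_congr rfl; intro j _
  have h1 : β i j ≤ 1 := by
    rw [← hr i]
    exact Finset.single_le_sum (f := fun j => β i j) (fun j _ => h0 _ _) (Finset.mem_univ j)
  simp only
  have hlast : (1 - β i j) ^ (1 - β i j) = Real.exp ((1 - β i j) * Real.log (1 - β i j)) := by
    rcases h1.lt_or_eq with h | h
    · rw [Real.rpow_def_of_pos (by linarith), mul_comm]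
    · rw [h]; simp
  rcases (h0 i j).lt_or_eq with hb | hb
  · have hpp : 0 < p i j := lt_of_le_of_ne (hp i j) fun h => hb.ne' (hz i j h.symm)
    rw [if_pos hpp, hlast, Real.rpow_def_of_pos (by positivity), Real.rpow_def_of_pos (by positivity),
      Real.rpow_def_of_pos hb, ← Real.exp_add, ← Real.exp_add, ← Real.exp_add,
      Real.log_div hb.ne' hpp.ne', Real.log_div hpp.ne' hb.ne', Real.log_div one_ne_zero hb.ne',
      Real.log_one]
    congr 1; ring
  · rw [← hb]; simp

theorem BP_lower_bound {n : ℕ} (p : Matrix (Fin n) (Fin n) ℝ)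
    (hp : ∀ i j, 0 ≤ p i j) (hperm : 0 < permanent p) :
    Real.exp (-(sInf ((fun β => FBP p β) '' {β | InPolytope p β}))) ≤
      permanent p := by
  rw [← Real.le_log_iff_exp_le hperm, neg_le]
  apply le_csInf
  · obtain ⟨σ, _, hσ⟩ := Finset.exists_ne_zero_of_sum_ne_zero hperm.ne'
    rw [Finset.prod_ne_zero_iff] at hσ
    refine Set.Nonempty.image _ ⟨fun i j => if σ i = j then 1 else 0, ⟨?_, ?_, ?_⟩, ?_⟩
    · intro i j; dsimp only; split_ifs <;> norm_num
    · intro i; simp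
    · intro j
      simp only [← Equiv.eq_symm_apply]; simp
    · intro i j hij
      dsimp only
      rw [if_neg]
      rintro rfl; exact hσ i (by simp) hij
  · rintro _ ⟨β, hβ, rfl⟩
    rw [neg_le, Real.le_log_iff_exp_le hperm]
    exact FBP_ge p β hp hβ
end

section
/- Let φ be an n×n doubly stochastic real matrix. Then perm(φ) ≥ Z_{o-BP}(φ) ≥ ∏_{(i,j): φ_ij>0} (1−φ_ij)^{1−φ_ij}, where Z_{o-BP}(φ) = exp(−min_{β∈𝓑_φ} F_BP(β|φ)) and the convention 0^0 = 1 is used in the rightmost product. -/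
open scoped BigOperators

/-- Row operator. -/
def rowOp {ι : Type*} [DecidableEq ι] (w : ι → ι → ℝ) (L : ι → ℝ) (i : ι) (F : Finset ι → ℝ) :
    Finset ι → ℝ :=
  fun Y => L i * F Y + ∑ k ∈ Y, w i k * F (Y.erase k)

theorem rowOp_comm {ι : Type*} [DecidableEq ι] (w : ι → ι → ℝ) (L : ι → ℝ) (i l : ι)
    (F : Finset ι → ℝ) : rowOp w L i (rowOp w L l F) = rowOp w L l (rowOp w L i F) := by
  funext Y
  simp only [rowOp, mul_add, Finset.sum_add_distrib, Finset.mul_sum]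
  have h : ∑ x ∈ Y, ∑ k ∈ Y.erase x, w i x * (w l k * F ((Y.erase x).erase k))
      = ∑ x ∈ Y, ∑ k ∈ Y.erase x, w l x * (w i k * F ((Y.erase x).erase k)) := by
    rw [Finset.sum_comm' (t' := Y) (s' := fun k => Y.erase k)]
    · refine Finset.sum_congr rfl fun x _ => Finset.sum_congr rfl fun k _ => ?_
      rw [Finset.erase_right_comm]; ring
    · intro x y
      simp only [Finset.mem_erase]
      tauto
  rw [h]
  have h1 : ∑ x ∈ Y, w i x * (L l * F (Y.erase x)) = ∑ x ∈ Y, L l * (w i x * F (Y.erase x)) :=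
    Finset.sum_congr rfl fun _ _ => by ring
  have h2 : ∑ x ∈ Y, w l x * (L i * F (Y.erase x)) = ∑ x ∈ Y, L i * (w l x * F (Y.erase x)) :=
    Finset.sum_congr rfl fun _ _ => by ring
  rw [h1, h2]; ring

instance rowOp_leftComm {ι : Type*} [DecidableEq ι] (w : ι → ι → ℝ) (L : ι → ℝ) :
    LeftCommutative (rowOp w L) := ⟨fun i l F => rowOp_comm w L i l F⟩

/-- Weighted monomer-dimer partition function. -/
def mm {ι : Type*} [DecidableEq ι] (w : ι → ι → ℝ) (L K : ι → ℝ) (X : Finset ι) :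
    Finset ι → ℝ :=
  X.val.foldr (rowOp w L) (fun Y => ∏ j ∈ Y, K j)

section
variable {ι : Type*} [DecidableEq ι] (w : ι → ι → ℝ) (L K : ι → ℝ)

theorem mm_empty (Y : Finset ι) : mm w L K ∅ Y = ∏ j ∈ Y, K j := by
  simp [mm]

theorem mm_insert {i : ι} {X : Finset ι} (hi : i ∉ X) (Y : Finset ι) :
    mm w L K (insert i X) Y = L i * mm w L K X Y + ∑ k ∈ Y, w i k * mm w L K X (Y.erase k) := by
  simp only [mm, Finset.insert_val_of_notMem hi, Multiset.foldr_cons]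
  rfl

theorem mm_col (X : Finset ι) : ∀ {j : ι} {Y : Finset ι}, j ∉ Y →
    mm w L K X (insert j Y) = K j * mm w L K X Y + ∑ l ∈ X, w l j * mm w L K (X.erase l) Y := by
  induction X using Finset.induction_on with
  | empty => intro j Y hj; simp [mm_empty, Finset.prod_insert hj]
  | insert i X hi ih =>
    intro j Y hj
    rw [mm_insert _ _ _ hi, mm_insert _ _ _ hi, Finset.sum_insert hj, Finset.sum_insert hi,
      Finset.erase_insert hj, Finset.erase_insert hi, ih hj]
    have h1 : ∑ k ∈ Y, w i k * mm w L K X ((insert j Y).erase k)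
        = ∑ k ∈ Y, w i k * (K j * mm w L K X (Y.erase k)
          + ∑ l ∈ X, w l j * mm w L K (X.erase l) (Y.erase k)) := by
      refine Finset.sum_congr rfl fun k hk => ?_
      have hjk : j ≠ k := fun h => hj (h ▸ hk)
      rw [Finset.erase_insert_of_ne hjk, ih (fun h => hj (Finset.mem_of_mem_erase h))]
    have h2 : ∑ l ∈ X, w l j * mm w L K ((insert i X).erase l) Y
        = ∑ l ∈ X, w l j * (L i * mm w L K (X.erase l) Y
          + ∑ k ∈ Y, w i k * mm w L K (X.erase l) (Y.erase k)) := by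
      refine Finset.sum_congr rfl fun l hl => ?_
      have hil : i ≠ l := fun h => hi (h ▸ hl)
      rw [Finset.erase_insert_of_ne hil, mm_insert _ _ _ (fun h => hi (Finset.mem_of_mem_erase h))]
    rw [h1, h2]
    simp only [mul_add, Finset.sum_add_distrib, Finset.mul_sum]
    have h3 : ∑ x ∈ Y, ∑ l ∈ X, w i x * (w l j * mm w L K (X.erase l) (Y.erase x))
      = ∑ l ∈ X, ∑ x ∈ Y, w l j * (w i x * mm w L K (X.erase l) (Y.erase x)) := by
      rw [Finset.sum_comm]
      exact Finset.sum_congr rfl fun _ _ => Finset.sum_congr rfl fun _ _ => by ring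
    have h4 : ∑ x ∈ Y, w i x * (K j * mm w L K X (Y.erase x))
      = ∑ x ∈ Y, K j * (w i x * mm w L K X (Y.erase x)) :=
      Finset.sum_congr rfl fun _ _ => by ring
    have h5 : ∑ l ∈ X, L i * (w l j * mm w L K (X.erase l) Y)
      = ∑ l ∈ X, w l j * (L i * mm w L K (X.erase l) Y) :=
      Finset.sum_congr rfl fun _ _ => by ring
    rw [h3, h4, h5]; ring

theorem mm_congr {w w' : ι → ι → ℝ} {L L' K K' : ι → ℝ} (X : Finset ι) : ∀ (Y : Finset ι),
    (∀ i ∈ X, ∀ j ∈ Y, w i j = w' i j) → (∀ i ∈ X, L i = L' i) → (∀ j ∈ Y, K j = K' j) →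
    mm w L K X Y = mm w' L' K' X Y := by
  induction X using Finset.induction_on with
  | empty => intro Y _ _ hK; simp only [mm_empty]; exact Finset.prod_congr rfl hK
  | insert i X hi ih =>
    intro Y hw hL hK
    rw [mm_insert _ _ _ hi, mm_insert _ _ _ hi, hL i (Finset.mem_insert_self _ _),
      ih Y (fun a ha => hw a (Finset.mem_insert_of_mem ha))
        (fun a ha => hL a (Finset.mem_insert_of_mem ha)) hK]
    congr 1
    refine Finset.sum_congr rfl fun k hk => ?_
    rw [hw i (Finset.mem_insert_self _ _) k hk,
      ih (Y.erase k) (fun a ha b hb => hw a (Finset.mem_insert_of_mem ha) b (Finset.mem_of_mem_erase hb))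
        (fun a ha => hL a (Finset.mem_insert_of_mem ha))
        (fun b hb => hK b (Finset.mem_of_mem_erase hb))]

variable {w L K}

theorem mm_nonneg (hw : ∀ i j, 0 ≤ w i j) (hL : ∀ i, 0 ≤ L i) (hK : ∀ j, 0 ≤ K j)
    (X : Finset ι) : ∀ Y, 0 ≤ mm w L K X Y := by
  induction X using Finset.induction_on with
  | empty => intro Y; rw [mm_empty]; exact Finset.prod_nonneg fun j _ => hK j
  | insert i X hi ih =>
    intro Y
    rw [mm_insert _ _ _ hi]
    exact add_nonneg (mul_nonneg (hL i) (ih Y))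
      (Finset.sum_nonneg fun k _ => mul_nonneg (hw i k) (ih _))

/-- Positive correlation of vertices on opposite sides. -/
theorem mm_corr (hw : ∀ i j, 0 ≤ w i j) (hL : ∀ i, 0 ≤ L i) (hK : ∀ j, 0 ≤ K j) :
    ∀ (N : ℕ) (X Y : Finset ι) (i j : ι), X.card ≤ N → i ∉ X → j ∉ Y →
      mm w L K X (insert j Y) * mm w L K (insert i X) Y
        ≤ mm w L K (insert i X) (insert j Y) * mm w L K X Y := by
  intro N
  induction N with
  | zero =>
    intro X Y i j hX hi hj
    have : X = ∅ := by simpa using hX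
    subst this
    have hY : ∀ k ∈ Y, w i k * mm w L K ∅ ((insert j Y).erase k)
        = w i k * mm w L K ∅ (Y.erase k) * K j := by
      intro k hk
      have hjk : j ≠ k := fun h => hj (h ▸ hk)
      rw [Finset.erase_insert_of_ne hjk, mm_empty, mm_empty,
        Finset.prod_insert (fun h => hj (Finset.mem_of_mem_erase h))]; ring
    rw [mm_insert _ _ _ hi, mm_insert _ _ _ hi, Finset.sum_insert hj, Finset.erase_insert hj,
      Finset.sum_congr rfl hY, ← Finset.sum_mul]
    have e : mm w L K ∅ (insert j Y) = K j * mm w L K ∅ Y := by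
      rw [mm_empty, mm_empty, Finset.prod_insert hj]
    rw [e]
    nlinarith [mul_nonneg (hw i j) (mul_self_nonneg (mm w L K ∅ Y))]
  | succ N ih =>
    intro X Y i j hX hi hj
    -- negative correlation on the same side
    have neg : ∀ k ∈ Y, mm w L K X (insert j Y) * mm w L K X (Y.erase k)
        ≤ mm w L K X ((insert j Y).erase k) * mm w L K X Y := by
      intro k hk
      have hjk : j ≠ k := fun h => hj (h ▸ hk)
      obtain ⟨Z, hZ⟩ : ∃ Z, Z = Y.erase k := ⟨_, rfl⟩
      have hY : Y = insert k Z := by rw [hZ, Finset.insert_erase hk]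
      have hkZ : k ∉ Z := by simp [hZ]
      have hjZ : j ∉ Z := fun h => hj (by rw [hY]; exact Finset.mem_insert_of_mem h)
      rw [Finset.erase_insert_of_ne hjk, ← hZ, mm_col w L K X hj, mm_col w L K X hjZ, hY]
      rw [add_mul, add_mul]
      have : (∑ l ∈ X, w l j * mm w L K (X.erase l) (insert k Z)) * mm w L K X Z
          ≤ (∑ l ∈ X, w l j * mm w L K (X.erase l) Z) * mm w L K X (insert k Z) := by
        rw [Finset.sum_mul, Finset.sum_mul]
        refine Finset.sum_le_sum fun l hl => ?_
        have := ih (X.erase l) Z l k (by rw [Finset.card_erase_of_mem hl]; omega)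
          (by simp) hkZ
        rw [Finset.insert_erase hl] at this
        nlinarith [mul_le_mul_of_nonneg_left this (hw l j)]
      linarith
    rw [mm_insert _ _ _ hi, mm_insert _ _ _ hi, Finset.sum_insert hj, Finset.erase_insert hj]
    have : mm w L K X (insert j Y) * ∑ k ∈ Y, w i k * mm w L K X (Y.erase k)
        ≤ (∑ k ∈ Y, w i k * mm w L K X ((insert j Y).erase k)) * mm w L K X Y := by
      rw [Finset.sum_mul, Finset.mul_sum]
      refine Finset.sum_le_sum fun k hk => ?_
      nlinarith [mul_le_mul_of_nonneg_left (neg k hk) (hw i k)]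
    nlinarith [mul_nonneg (hw i j) (mul_self_nonneg (mm w L K X Y))]

theorem mm_w_zero (X Y : Finset ι) (h : ∀ i j, w i j = 0) :
    mm w L K X Y = (∏ i ∈ X, L i) * ∏ j ∈ Y, K j := by
  induction X using Finset.induction_on with
  | empty => simp [mm_empty]
  | insert i X hi ih => rw [mm_insert _ _ _ hi, ih, Finset.prod_insert hi]; simp [h, mul_assoc]

/-- The affine expansion at an edge, uniform in the data at this edge. -/
theorem mm_expand (hw : ∀ i j, 0 ≤ w i j) (hL : ∀ i, 0 ≤ L i) (hK : ∀ j, 0 ≤ K j)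
    (X Y : Finset ι) (i j : ι) (hi : i ∉ X) (hj : j ∉ Y) :
    ∃ A B C D : ℝ, 0 ≤ A ∧ 0 ≤ B ∧ 0 ≤ C ∧ 0 ≤ D ∧ B * C ≤ A * D ∧
      ∀ (w' : ι → ι → ℝ) (L' K' : ι → ℝ),
        (∀ a b, (a, b) ≠ (i, j) → w' a b = w a b) → (∀ a, a ≠ i → L' a = L a) →
        (∀ b, b ≠ j → K' b = K b) →
        mm w' L' K' (insert i X) (insert j Y)
          = A + B * L' i + C * K' j + D * (L' i * K' j) + w' i j * D := by
  have key : ∀ (w' : ι → ι → ℝ) (L' K' : ι → ℝ),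
        (∀ a b, (a, b) ≠ (i, j) → w' a b = w a b) → (∀ a, a ≠ i → L' a = L a) →
        (∀ b, b ≠ j → K' b = K b) →
        mm w' L' K' (insert i X) (insert j Y)
          = (∑ k ∈ Y, w i k * ∑ l ∈ X, w l j * mm w L K (X.erase l) (Y.erase k))
            + (∑ l ∈ X, w l j * mm w L K (X.erase l) Y) * L' i
            + (∑ k ∈ Y, w i k * mm w L K X (Y.erase k)) * K' j
            + mm w L K X Y * (L' i * K' j) + w' i j * mm w L K X Y := by
    intro w' L' K' h1 h2 h3
    have cg : ∀ X' ⊆ X, ∀ Y' ⊆ Y, mm w' L' K' X' Y' = mm w L K X' Y' := by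
      intro X' hX' Y' hY'
      refine mm_congr X' Y' (fun a ha b hb => h1 a b ?_) (fun a ha => h2 a ?_) (fun b hb => h3 b ?_)
      · rintro h; simp only [Prod.mk.injEq] at h; exact hi (h.1 ▸ hX' ha)
      · rintro rfl; exact hi (hX' ha)
      · rintro rfl; exact hj (hY' hb)
    have wl : ∀ l ∈ X, w' l j = w l j := fun l hl => h1 l j (by
      rintro h; simp only [Prod.mk.injEq] at h; exact hi (h.1 ▸ hl))
    have wk : ∀ k ∈ Y, w' i k = w i k := fun k hk => h1 i k (by
      rintro h; simp only [Prod.mk.injEq] at h; exact hj (h.2 ▸ hk))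
    have col : ∀ Y' ⊆ Y, mm w' L' K' X (insert j Y')
        = K' j * mm w L K X Y' + ∑ l ∈ X, w l j * mm w L K (X.erase l) Y' := by
      intro Y' hY'
      rw [mm_col _ _ _ _ (fun h => hj (hY' h)), cg X subset_rfl Y' hY']
      congr 1
      refine Finset.sum_congr rfl fun l hl => ?_
      rw [wl l hl, cg _ (Finset.erase_subset _ _) Y' hY']
    rw [mm_insert _ _ _ hi, Finset.sum_insert hj, Finset.erase_insert hj, col Y subset_rfl,
      cg X subset_rfl Y subset_rfl]
    have : ∑ k ∈ Y, w' i k * mm w' L' K' X ((insert j Y).erase k)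
        = ∑ k ∈ Y, (w i k * mm w L K X (Y.erase k) * K' j
          + w i k * ∑ l ∈ X, w l j * mm w L K (X.erase l) (Y.erase k)) := by
      refine Finset.sum_congr rfl fun k hk => ?_
      have hjk : j ≠ k := fun h => hj (h ▸ hk)
      rw [Finset.erase_insert_of_ne hjk, col _ (Finset.erase_subset _ _), wk k hk]; ring
    rw [this, Finset.sum_add_distrib, ← Finset.sum_mul]; ring
  have nn := mm_nonneg hw hL hK
  refine ⟨_, _, _, _, ?_, ?_, ?_, nn X Y, ?_, key⟩
  · exact Finset.sum_nonneg fun k _ => mul_nonneg (hw _ _)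
      (Finset.sum_nonneg fun l _ => mul_nonneg (hw _ _) (nn _ _))
  · exact Finset.sum_nonneg fun k _ => mul_nonneg (hw _ _) (nn _ _)
  · exact Finset.sum_nonneg fun k _ => mul_nonneg (hw _ _) (nn _ _)
  · -- correlation with the edge weight set to zero
    let w0 : ι → ι → ℝ := fun a b => if (a, b) = (i, j) then 0 else w a b
    let L0 : ι → ℝ := fun a => if a = i then 0 else L a
    let K0 : ι → ℝ := fun b => if b = j then 0 else K b
    have hw0 : ∀ a b, 0 ≤ w0 a b := fun a b => by
      simp only [w0]; split_ifs; exacts [le_rfl, hw a b]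
    have hL0 : ∀ a, 0 ≤ L0 a := fun a => by simp only [L0]; split_ifs; exacts [le_rfl, hL a]
    have hK0 : ∀ a, 0 ≤ K0 a := fun a => by simp only [K0]; split_ifs; exacts [le_rfl, hK a]
    have c := mm_corr hw0 hL0 hK0 X.card X Y i j le_rfl hi hj
    have e := key w0 L0 K0 (fun a b h => by simp only [w0, if_neg h])
      (fun a h => by simp only [L0, if_neg h]) (fun a h => by simp only [K0, if_neg h])
    have cg : ∀ X' ⊆ X, ∀ Y' ⊆ Y, mm w0 L0 K0 X' Y' = mm w L K X' Y' := by
      intro X' hX' Y' hY'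
      refine mm_congr X' Y' (fun a ha b hb => if_neg ?_) (fun a ha => if_neg ?_) (fun b hb => if_neg ?_)
      · rintro h; simp only [Prod.mk.injEq] at h; exact hi (h.1 ▸ hX' ha)
      · rintro rfl; exact hi (hX' ha)
      · rintro rfl; exact hj (hY' hb)
    have z1 : L0 i = 0 := by simp [L0]
    have z2 : K0 j = 0 := by simp [K0]
    have z3 : w0 i j = 0 := by simp [w0]
    rw [mm_col _ _ _ _ hj, mm_insert _ _ _ hi Y, e, z1, z2, z3, cg X subset_rfl Y subset_rfl] at c
    have s1 : ∑ l ∈ X, w0 l j * mm w0 L0 K0 (X.erase l) Y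
        = ∑ l ∈ X, w l j * mm w L K (X.erase l) Y := by
      refine Finset.sum_congr rfl fun l hl => ?_
      rw [cg _ (Finset.erase_subset _ _) _ subset_rfl]
      congr 1
      refine if_neg ?_
      rintro h; simp only [Prod.mk.injEq] at h; exact hi (h.1 ▸ hl)
    have s2 : ∑ k ∈ Y, w0 i k * mm w0 L0 K0 X (Y.erase k)
        = ∑ k ∈ Y, w i k * mm w L K X (Y.erase k) := by
      refine Finset.sum_congr rfl fun k hk => ?_
      rw [cg _ subset_rfl _ (Finset.erase_subset _ _)]
      congr 1
      refine if_neg ?_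
      rintro h; simp only [Prod.mk.injEq] at h; exact hj (h.2 ▸ hk)
    rw [s1, s2] at c
    simpa using c

/-- Without monomers we get a sum over bijections `X → Y`. -/
theorem mm_zero [Fintype ι] (a : ι → ι → ℝ) (X : Finset ι) : ∀ Y : Finset ι,
    mm a (fun _ => 0) (fun _ => 0) X Y
      = ∑ g : ι → ι with (∀ i, i ∉ X → g i = i) ∧ Set.InjOn g X ∧ X.image g = Y,
          ∏ i ∈ X, a i (g i) := by
  induction X using Finset.induction_on with
  | empty =>
    intro Y
    rw [mm_empty]
    rcases Y.eq_empty_or_nonempty with rfl | ⟨y, hy⟩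
    · have : (Finset.univ.filter fun g : ι → ι => (∀ i, i ∉ (∅ : Finset ι) → g i = i) ∧
          Set.InjOn g ((∅ : Finset ι) : Set ι) ∧ (∅ : Finset ι).image g = ∅) = {id} := by
        ext g; simp [funext_iff]
      rw [this]; simp
    · rw [Finset.prod_eq_zero hy rfl, Finset.sum_eq_zero]
      intro g hg
      have hg' := (Finset.mem_filter.mp hg).2.2.2
      rw [← hg'] at hy; simp at hy
  | insert i X hi ih =>
    intro Y
    rw [mm_insert _ _ _ hi, zero_mul, zero_add]
    simp only [ih, Finset.mul_sum]
    rw [Finset.sum_sigma']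
    refine Finset.sum_bij' (fun p _ => Function.update p.2 i p.1)
      (fun g _ => ⟨g i, Function.update g i i⟩) ?_ ?_ ?_ ?_ ?_
    · rintro ⟨k, g⟩ h
      simp only [Finset.mem_sigma, Finset.mem_filter, Finset.mem_univ, true_and] at h ⊢
      obtain ⟨hk, h1, h2, h3⟩ := h
      have eqX : ∀ l ∈ X, Function.update g i k l = g l := fun l hl =>
        Function.update_of_ne (ne_of_mem_of_not_mem hl hi) _ _
      have him : X.image (Function.update g i k) = Y.erase k := by
        rw [← h3]; exact Finset.image_congr eqX
      refine ⟨?_, ?_, ?_⟩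
      · intro l hl
        simp only [Finset.mem_insert, not_or] at hl
        rw [Function.update_of_ne hl.1, h1 l hl.2]
      · rw [Finset.coe_insert, Set.injOn_insert (by simpa using hi)]
        refine ⟨?_, ?_⟩
        · intro x hx y hy hxy
          rw [eqX x hx, eqX y hy] at hxy
          exact h2 hx hy hxy
        · rw [← Finset.coe_image, him]; simp
      · rw [Finset.image_insert, him]; simp [Finset.insert_erase hk]
    · rintro g h
      simp only [Finset.mem_sigma, Finset.mem_filter, Finset.mem_univ, true_and] at h ⊢
      obtain ⟨h1, h2, h3⟩ := h
      have eqX : ∀ l ∈ X, Function.update g i i l = g l := fun l hl =>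
        Function.update_of_ne (ne_of_mem_of_not_mem hl hi) _ _
      rw [Finset.coe_insert, Set.injOn_insert (by simpa using hi)] at h2
      refine ⟨?_, ?_, ?_, ?_⟩
      · rw [← h3]; simp
      · intro l hl
        by_cases hli : l = i
        · subst hli; simp
        · rw [Function.update_of_ne hli]; exact h1 l (by simp [hli, hl])
      · intro x hx y hy hxy
        rw [eqX x hx, eqX y hy] at hxy
        exact h2.1 hx hy hxy
      · rw [Finset.image_congr (g := g) eqX, ← h3, Finset.image_insert, Finset.erase_insert]
        have := h2.2
        rwa [← Finset.coe_image] at this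
    · rintro ⟨k, g⟩ h
      simp only [Finset.mem_sigma, Finset.mem_filter, Finset.mem_univ, true_and] at h
      have : g i = i := h.2.1 i hi
      simp only [Function.update_self, Function.update_idem, Sigma.mk.injEq, heq_eq_eq, true_and]
      exact Function.update_eq_self_iff.mpr this.symm
    · rintro g h
      simp
    · rintro ⟨k, g⟩ h
      rw [Finset.prod_insert hi]
      simp only [Function.update_self]
      congr 1
      refine Finset.prod_congr rfl fun l hl => ?_
      rw [Function.update_of_ne (ne_of_mem_of_not_mem hl hi)]

theorem mm_perm [Fintype ι] (a : ι → ι → ℝ) :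
    mm a (fun _ => 0) (fun _ => 0) Finset.univ Finset.univ
      = ∑ σ : Equiv.Perm ι, ∏ i, a i (σ i) := by
  rw [mm_zero]
  symm
  refine Finset.sum_bij (fun σ _ => (σ : ι → ι)) ?_ ?_ ?_ ?_
  · intro σ _
    simp [Finset.image_univ_of_surjective σ.surjective, σ.injective]
  · intro σ _ τ _ h
    exact DFunLike.coe_injective h
  · intro g hg
    simp only [Finset.mem_filter, Finset.coe_univ] at hg
    have hinj : Function.Injective g := Set.injOn_univ.mp hg.2.2.1
    exact ⟨Equiv.ofBijective g (Finite.injective_iff_bijective.mp hinj), Finset.mem_univ _, rfl⟩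
  · intro σ _; rfl

end

theorem step_core {a b c d β C : ℝ} (ha : 0 < a) (hd : 0 < d) (hb : 0 ≤ b) (hc : 0 ≤ c)
    (h : b * c ≤ a * d) (hβ0 : 0 < β) (hβ1 : β < 1)
    (H : ∀ s t : ℝ, 0 < s → 0 < t → C * (s * t) ^ β ≤ a + b * s + c * t + d * (s * t)) :
    C * ((1 - β) ^ (1 - β) * β ^ β) ≤ a + d := by
  have had : 0 < a * d := mul_pos ha hd
  have hγ : 0 < 1 - β := by linarith
  obtain ⟨b', c', hb', hc', hbb, hcc, hbc⟩ : ∃ b' c' : ℝ, 0 < b' ∧ 0 < c' ∧ b ≤ b' ∧ c ≤ c' ∧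
      b' * c' = a * d := by
    rcases hb.lt_or_eq with hb | hb
    · refine ⟨b, a * d / b, hb, by positivity, le_rfl, ?_, by field_simp⟩
      rw [le_div_iff₀ hb]; linarith
    · have : 0 < max c 1 := lt_max_of_lt_right one_pos
      exact ⟨a * d / max c 1, max c 1, by positivity, this, by rw [← hb]; positivity,
        le_max_left _ _, by field_simp⟩
  obtain ⟨r, hr⟩ : ∃ r, r = β / (1 - β) := ⟨_, rfl⟩
  have hrpos : 0 < r := by rw [hr]; positivity
  have hs : 0 < a * r / b' := by positivity
  have ht : 0 < a * r / c' := by positivity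
  have h1 := H _ _ hs ht
  have est : a * r / b' * (a * r / c') = a * r ^ 2 / d := by
    have : a * r / b' * (a * r / c') = a ^ 2 * r ^ 2 / (b' * c') := by field_simp
    rw [this, hbc]; field_simp
  have hle : a + b * (a * r / b') + c * (a * r / c') + d * (a * r / b' * (a * r / c'))
      ≤ a * (1 + r) ^ 2 := by
    rw [est]
    have e1 : b * (a * r / b') ≤ a * r := by
      calc b * (a * r / b') ≤ b' * (a * r / b') := by gcongr
        _ = a * r := by field_simp
    have e2 : c * (a * r / c') ≤ a * r := by
      calc c * (a * r / c') ≤ c' * (a * r / c') := by gcongr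
        _ = a * r := by field_simp
    have e3 : d * (a * r ^ 2 / d) = a * r ^ 2 := by field_simp
    rw [e3]; nlinarith
  rw [est] at h1 hle
  have h2 : C * (a * r ^ 2 / d) ^ β ≤ a * (1 + r) ^ 2 := h1.trans hle
  have e4 : 1 + r = 1 / (1 - β) := by rw [hr]; field_simp; ring
  -- AM-GM
  have amgm := Real.geom_mean_le_arith_mean2_weighted hγ.le hβ0.le
    (p₁ := a / (1 - β)) (p₂ := d / β) (by positivity) (by positivity) (by ring)
  have e5 : (1 - β) * (a / (1 - β)) + β * (d / β) = a + d := by field_simp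
  rw [e5] at amgm
  refine le_trans ?_ amgm
  have hp : 0 < (a * r ^ 2 / d) ^ β := by positivity
  rw [← mul_le_mul_iff_left₀ hp]
  calc C * ((1 - β) ^ (1 - β) * β ^ β) * (a * r ^ 2 / d) ^ β
      = (C * (a * r ^ 2 / d) ^ β) * ((1 - β) ^ (1 - β) * β ^ β) := by ring
    _ ≤ (a * (1 + r) ^ 2) * ((1 - β) ^ (1 - β) * β ^ β) := by gcongr
    _ = (a / (1 - β)) ^ (1 - β) * (d / β) ^ β * (a * r ^ 2 / d) ^ β := by
      rw [e4, hr]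
      apply Real.log_injOn_pos
      · simp only [Set.mem_Ioi]; positivity
      · simp only [Set.mem_Ioi]; positivity
      have n1 := ha.ne'
      have n2 := hd.ne'
      have n3 := hβ0.ne'
      have n4 := hγ.ne'
      rw [Real.log_mul (by positivity) (by positivity), Real.log_mul (by positivity) (by positivity),
        Real.log_mul (by positivity) (by positivity), Real.log_mul (by positivity) (by positivity),
        Real.log_mul (by positivity) (by positivity),
        Real.log_rpow (by positivity), Real.log_rpow (by positivity), Real.log_rpow (by positivity),
        Real.log_rpow (by positivity), Real.log_rpow (by positivity),
        Real.log_pow, Real.log_div (by positivity) (by positivity),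
        Real.log_div (by positivity) (by positivity), Real.log_div (by positivity) (by positivity),
        Real.log_div (by positivity) (by positivity), Real.log_mul (by positivity) (by positivity),
        Real.log_pow, Real.log_div (by positivity) (by positivity), Real.log_one]
      push_cast
      ring

theorem step_zero {a b c d C : ℝ}
    (H : ∀ s : ℝ, 0 < s → C ≤ a + b * s + c * s + d * (s * s)) : C ≤ a := by
  have hc : Filter.Tendsto (fun s : ℝ => a + b * s + c * s + d * (s * s)) (nhdsWithin 0 (Set.Ioi 0))
      (nhds (a + b * 0 + c * 0 + d * (0 * 0))) := by
    apply Filter.Tendsto.mono_left _ nhdsWithin_le_nhds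
    apply Continuous.tendsto
    fun_prop
  have := ge_of_tendsto hc (b := C) (by
    filter_upwards [self_mem_nhdsWithin] with s hs using H s hs)
  simpa using this

theorem step_lemma {a b c d β C : ℝ} (ha : 0 ≤ a) (hd : 0 ≤ d) (hb : 0 ≤ b) (hc : 0 ≤ c)
    (h : b * c ≤ a * d) (hβ0 : 0 ≤ β) (hβ1 : β ≤ 1)
    (H : ∀ s t : ℝ, 0 < s → 0 < t → C * (s * t) ^ β ≤ a + b * s + c * t + d * (s * t)) :
    C * ((1 - β) ^ (1 - β) * β ^ β) ≤ a + d := by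
  rcases hβ0.eq_or_lt with rfl | hβ0
  · have : C ≤ a := step_zero (b := b) (c := c) (d := d) fun s hs => by simpa using H s s hs hs
    simpa using this.trans (by linarith)
  rcases hβ1.eq_or_lt with rfl | hβ1
  · have : C ≤ d := step_zero (b := b) (c := c) (d := a) fun s hs => by
      have h1 := H s⁻¹ s⁻¹ (by positivity) (by positivity)
      rw [Real.rpow_one] at h1
      have h2 := mul_le_mul_of_nonneg_right h1 (mul_self_nonneg s)
      have e1 : C * (s⁻¹ * s⁻¹) * (s * s) = C := by field_simp
      have e2 : (a + b * s⁻¹ + c * s⁻¹ + d * (s⁻¹ * s⁻¹)) * (s * s)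
        = d + b * s + c * s + a * (s * s) := by field_simp; ring
      rwa [e1, e2] at h2
    simpa using this.trans (by linarith)
  refine le_of_forall_pos_le_add fun ε hε => ?_
  have := step_core (a := a + ε / 2) (d := d + ε / 2) (b := b) (c := c) (β := β) (C := C)
    (by positivity) (by positivity) hb hc (by nlinarith) hβ0 hβ1 (fun s t hs ht => by
      have := H s t hs ht
      have h3 : 0 < s * t := by positivity
      nlinarith)
  linarith

theorem amgm_row_s10 {ι : Type*} [Fintype ι] (b x : ι → ℝ) (hb : ∀ j, 0 ≤ b j) (hs : ∑ j, b j = 1)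
    (hx : ∀ j, 0 ≤ x j) : ∏ j, (x j / b j) ^ b j ≤ ∑ j, x j := by
  refine (Real.geom_mean_le_arith_mean_weighted Finset.univ b (fun j => x j / b j)
    (fun j _ => hb j) hs (fun j _ => div_nonneg (hx j) (hb j))).trans ?_
  refine Finset.sum_le_sum fun j _ => ?_
  rcases (hb j).eq_or_lt with h | h
  · rw [← h]; simpa using hx j
  · rw [mul_div_cancel₀ _ h.ne']

/-- Main induction: process the edges one at a time. -/
theorem bethe_induction {ι : Type*} [Fintype ι] [DecidableEq ι] (a β : ι → ι → ℝ)
    (ha : ∀ i j, 0 ≤ a i j) (hβ : ∀ i j, 0 ≤ β i j) (hr : ∀ i, ∑ j, β i j = 1)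
    (hcs : ∀ j, ∑ i, β i j = 1) (E : Finset (ι × ι)) :
    ∀ y z : ι → ι → ℝ, (∀ i j, 0 < y i j) → (∀ i j, 0 < z i j) →
    (∏ e : ι × ι, (a e.1 e.2 / β e.1 e.2) ^ β e.1 e.2 / β e.1 e.2 ^ β e.1 e.2 *
      (if e ∈ E then (1 - β e.1 e.2) ^ (1 - β e.1 e.2) * β e.1 e.2 ^ β e.1 e.2
        else (y e.1 e.2 * z e.1 e.2) ^ β e.1 e.2))
    ≤ mm (fun i j => if (i, j) ∈ E then a i j else 0)
        (fun i => ∑ j, if (i, j) ∈ E then 0 else a i j * y i j)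
        (fun j => ∑ i, if (i, j) ∈ E then 0 else z i j) Finset.univ Finset.univ := by
  have hβ1 : ∀ i j, β i j ≤ 1 := fun i j => by
    rw [← hr i]; exact Finset.single_le_sum (fun k _ => hβ i k) (Finset.mem_univ j)
  induction E using Finset.induction_on with
  | empty =>
    intro y z hy hz
    rw [mm_w_zero _ _ (by simp)]
    simp only [Finset.notMem_empty, if_false]
    have h1 : ∏ i, ∏ j, (a i j * y i j / β i j) ^ β i j ≤ ∏ i, ∑ j, a i j * y i j := by
      refine Finset.prod_le_prod (fun i _ => Finset.prod_nonneg fun j _ =>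
        Real.rpow_nonneg (div_nonneg (mul_nonneg (ha i j) (hy i j).le) (hβ i j)) _) fun i _ => ?_
      exact amgm_row_s10 _ (fun j => a i j * y i j) (hβ i) (hr i)
        fun j => mul_nonneg (ha i j) (hy i j).le
    have h2 : ∏ j, ∏ i, (z i j / β i j) ^ β i j ≤ ∏ j, ∑ i, z i j := by
      refine Finset.prod_le_prod (fun j _ => Finset.prod_nonneg fun i _ =>
        Real.rpow_nonneg (div_nonneg (hz i j).le (hβ i j)) _) fun j _ => ?_
      exact amgm_row_s10 (fun i => β i j) (fun i => z i j) (fun i => hβ i j) (hcs j)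
        fun i => (hz i j).le
    refine le_trans (le_of_eq ?_) (mul_le_mul h1 h2
      (Finset.prod_nonneg fun j _ => Finset.prod_nonneg fun i _ =>
        Real.rpow_nonneg (div_nonneg (hz i j).le (hβ i j)) _)
      (Finset.prod_nonneg fun i _ => Finset.sum_nonneg fun j _ => mul_nonneg (ha i j) (hy i j).le))
    rw [Finset.prod_comm (f := fun j i => (z i j / β i j) ^ β i j), Fintype.prod_prod_type,
      ← Finset.prod_mul_distrib]
    refine Finset.prod_congr rfl fun i _ => ?_
    rw [← Finset.prod_mul_distrib]
    refine Finset.prod_congr rfl fun j _ => ?_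
    dsimp only
    rw [mul_div_right_comm, Real.mul_rpow (div_nonneg (ha i j) (hβ i j)) (hy i j).le,
      Real.div_rpow (hz i j).le (hβ i j), Real.mul_rpow (hy i j).le (hz i j).le]
    ring
  | insert e E he ih =>
    obtain ⟨i, j⟩ := e
    intro y z hy hz
    obtain ⟨X, hX⟩ : ∃ X, X = (Finset.univ : Finset ι).erase i := ⟨_, rfl⟩
    obtain ⟨Y, hY⟩ : ∃ Y, Y = (Finset.univ : Finset ι).erase j := ⟨_, rfl⟩
    have hiX : i ∉ X := by simp [hX]
    have hjY : j ∉ Y := by simp [hY]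
    have huX : insert i X = Finset.univ := by rw [hX, Finset.insert_erase (Finset.mem_univ i)]
    have huY : insert j Y = Finset.univ := by rw [hY, Finset.insert_erase (Finset.mem_univ j)]
    obtain ⟨w, hw⟩ : ∃ w : ι → ι → ℝ,
        w = fun k l => if (k, l) ∈ insert (i, j) E then a k l else 0 := ⟨_, rfl⟩
    obtain ⟨L, hL⟩ : ∃ L : ι → ℝ,
        L = fun k => ∑ l, if (k, l) ∈ insert (i, j) E then 0 else a k l * y k l := ⟨_, rfl⟩
    obtain ⟨K, hK⟩ : ∃ K : ι → ℝ,
        K = fun l => ∑ k, if (k, l) ∈ insert (i, j) E then 0 else z k l := ⟨_, rfl⟩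
    have w0 : ∀ k l, 0 ≤ w k l := fun k l => by
      rw [hw]; dsimp only; split_ifs; exacts [ha k l, le_rfl]
    have L0 : ∀ k, 0 ≤ L k := fun k => by
      rw [hL]; refine Finset.sum_nonneg fun l _ => ?_
      split_ifs; exacts [le_rfl, mul_nonneg (ha k l) (hy k l).le]
    have K0 : ∀ k, 0 ≤ K k := fun k => by
      rw [hK]; refine Finset.sum_nonneg fun l _ => ?_
      split_ifs; exacts [le_rfl, (hz l k).le]
    obtain ⟨A, B, C, D, hA, hB, hC, hD, hBC, hexp⟩ := mm_expand w0 L0 K0 X Y i j hiX hjY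
    rw [huX, huY] at hexp
    rw [← hw, ← hL, ← hK, hexp w L K (fun _ _ _ => rfl) (fun _ _ => rfl) (fun _ _ => rfl)]
    have hwij : w i j = a i j := by rw [hw]; simp
    obtain ⟨G, hG⟩ : ∃ G : ℝ, G = (a i j / β i j) ^ β i j / β i j ^ β i j := ⟨_, rfl⟩
    obtain ⟨R, hR⟩ : ∃ R : ℝ, R = ∏ e ∈ Finset.univ.erase (i, j),
      (a e.1 e.2 / β e.1 e.2) ^ β e.1 e.2 / β e.1 e.2 ^ β e.1 e.2 *
      (if e ∈ E then (1 - β e.1 e.2) ^ (1 - β e.1 e.2) * β e.1 e.2 ^ β e.1 e.2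
        else (y e.1 e.2 * z e.1 e.2) ^ β e.1 e.2) := ⟨_, rfl⟩
    have goal := step_lemma (a := A + B * L i + C * K j + D * (L i * K j)) (d := a i j * D)
      (b := a i j * (B + D * K j)) (c := C + D * L i) (β := β i j) (C := R * G)
      (by have := L0 i; have := K0 j; positivity)
      (mul_nonneg (ha i j) hD)
      (by have := L0 i; have := K0 j; have := ha i j; positivity)
      (by have := L0 i; positivity)
      (by nlinarith [mul_le_mul_of_nonneg_left hBC (ha i j)])
      (hβ i j) (hβ1 i j) ?_
    · rw [hwij, mul_comm (a i j) D] at *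
      refine le_trans (le_of_eq ?_) goal
      rw [← Finset.mul_prod_erase _ _ (Finset.mem_univ (i, j))]
      dsimp only
      rw [if_pos (Finset.mem_insert_self _ _), ← hG, hR]
      rw [Finset.prod_congr rfl (g := fun e : ι × ι =>
        (a e.1 e.2 / β e.1 e.2) ^ β e.1 e.2 / β e.1 e.2 ^ β e.1 e.2 *
        (if e ∈ E then (1 - β e.1 e.2) ^ (1 - β e.1 e.2) * β e.1 e.2 ^ β e.1 e.2
          else (y e.1 e.2 * z e.1 e.2) ^ β e.1 e.2))]
      · ring
      · intro e hee
        have hne : e ≠ (i, j) := (Finset.mem_erase.mp hee).1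
        simp only [Finset.mem_insert, hne, false_or]
    · intro s t hs ht
      let y' : ι → ι → ℝ := fun k l => if (k, l) = (i, j) then s else y k l
      let z' : ι → ι → ℝ := fun k l => if (k, l) = (i, j) then t else z k l
      have yij : y' i j = s := by simp [y']
      have zij : z' i j = t := by simp [z']
      have yne : ∀ k l, (k, l) ≠ (i, j) → y' k l = y k l := fun k l h => if_neg h
      have zne : ∀ k l, (k, l) ≠ (i, j) → z' k l = z k l := fun k l h => if_neg h
      have key := ih y' z' (fun k l => by simp only [y']; split_ifs; exacts [hs, hy k l])
        (fun k l => by simp only [z']; split_ifs; exacts [ht, hz k l])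
      have Lterm : ∀ k l, (if (k, l) ∈ E then 0 else a k l * y' k l)
          = (if (k, l) ∈ insert (i, j) E then 0 else a k l * y k l)
            + if (k, l) = (i, j) then a i j * s else 0 := by
        intro k l
        by_cases h : (k, l) = (i, j)
        · have h' := h
          simp only [Prod.mk.injEq] at h'
          obtain ⟨rfl, rfl⟩ := h'
          simp [he, yij]
        · simp [Finset.mem_insert, h, yne k l h]
      have Kterm : ∀ k l, (if (k, l) ∈ E then 0 else z' k l)
          = (if (k, l) ∈ insert (i, j) E then 0 else z k l)
            + if (k, l) = (i, j) then t else 0 := by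
        intro k l
        by_cases h : (k, l) = (i, j)
        · have h' := h
          simp only [Prod.mk.injEq] at h'
          obtain ⟨rfl, rfl⟩ := h'
          simp [he, zij]
        · simp [Finset.mem_insert, h, zne k l h]
      have Leq : ∀ k, (∑ l, if (k, l) ∈ E then 0 else a k l * y' k l)
          = L k + if k = i then a i j * s else 0 := by
        intro k
        rw [Finset.sum_congr rfl fun l _ => Lterm k l, Finset.sum_add_distrib, hL]
        congr 1
        by_cases h : k = i <;> simp [h]
      have Keq : ∀ l, (∑ k, if (k, l) ∈ E then 0 else z' k l)
          = K l + if l = j then t else 0 := by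
        intro l
        rw [Finset.sum_congr rfl fun k _ => Kterm k l, Finset.sum_add_distrib, hK]
        congr 1
        by_cases h : l = j <;> simp [h]
      rw [hexp] at key
      rotate_left
      · intro k l h
        rw [hw]
        simp only [Finset.mem_insert, h, false_or]
      · intro k h
        simp only [Leq, if_neg h, add_zero]
      · intro l h
        simp only [Keq, if_neg h, add_zero]
      simp only [Leq, Keq, if_true, if_neg he] at key
      rw [← Finset.mul_prod_erase _ _ (Finset.mem_univ (i, j))] at key
      dsimp only at key
      rw [if_neg he, yij, zij, ← hG] at key
      rw [Finset.prod_congr rfl (g := fun e : ι × ι =>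
        (a e.1 e.2 / β e.1 e.2) ^ β e.1 e.2 / β e.1 e.2 ^ β e.1 e.2 *
        (if e ∈ E then (1 - β e.1 e.2) ^ (1 - β e.1 e.2) * β e.1 e.2 ^ β e.1 e.2
          else (y e.1 e.2 * z e.1 e.2) ^ β e.1 e.2)), ← hR] at key
      · refine le_trans (le_of_eq (by ring)) (key.trans (le_of_eq (by ring)))
      · intro e hee
        have hne : (e.1, e.2) ≠ (i, j) := (Finset.mem_erase.mp hee).1
        rw [yne _ _ hne, zne _ _ hne]

theorem bethe_le_perm {n : ℕ} (a β : Matrix (Fin n) (Fin n) ℝ)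
    (ha : ∀ i j, 0 ≤ a i j) (hβ : DoublyStochastic β) :
    (∏ i, ∏ j, (a i j / β i j) ^ β i j * (1 - β i j) ^ (1 - β i j)) ≤ permanent a := by
  have h := bethe_induction a β ha hβ.1 hβ.2.1 hβ.2.2 Finset.univ (fun _ _ => 1) (fun _ _ => 1)
    (fun _ _ => one_pos) (fun _ _ => one_pos)
  simp only [Finset.mem_univ, if_true, Finset.sum_const_zero] at h
  rw [mm_perm, Fintype.prod_prod_type] at h
  refine le_trans (le_of_eq ?_) h
  refine Finset.prod_congr rfl fun i _ => Finset.prod_congr rfl fun j _ => ?_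
  have hpos : β i j ^ β i j ≠ 0 := by
    rcases (hβ.1 i j).eq_or_lt with h | h
    · rw [← h]; simp
    · positivity
  dsimp only
  field_simp

theorem exp_neg_FBP {n : ℕ} (φ β : Matrix (Fin n) (Fin n) ℝ) (hφ : ∀ i j, 0 ≤ φ i j)
    (hβ : InPolytope φ β) :
    Real.exp (-FBP φ β) = ∏ i, ∏ j, (φ i j / β i j) ^ β i j * (1 - β i j) ^ (1 - β i j) := by
  rw [FBP, ← Finset.sum_neg_distrib, Real.exp_sum]
  refine Finset.prod_congr rfl fun i _ => ?_
  rw [← Finset.sum_neg_distrib, Real.exp_sum]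
  refine Finset.prod_congr rfl fun j _ => ?_
  have hβ1 : β i j ≤ 1 := by
    rw [← hβ.1.2.1 i]; exact Finset.single_le_sum (fun k _ => hβ.1.1 i k) (Finset.mem_univ j)
  split_ifs with h
  · rw [neg_sub, sub_eq_add_neg, Real.exp_add, mul_comm]
    congr 1
    · rcases (hβ.1.1 i j).eq_or_lt with h0 | h0
      · rw [← h0]; simp
      · rw [Real.rpow_def_of_pos (by positivity), ← inv_div, Real.log_inv]
        congr 1; ring
    · rcases hβ1.eq_or_lt with h0 | h0
      · rw [h0]; simp
      · rw [Real.rpow_def_of_pos (by linarith), mul_comm]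
  · have h0 : φ i j = 0 := le_antisymm (not_lt.mp h) (hφ i j)
    rw [hβ.2 i j h0]; simp

theorem BP_bounds_doubly_stochastic {n : ℕ}
    (φ : Matrix (Fin n) (Fin n) ℝ) (hφ : DoublyStochastic φ) :
    Real.exp (-(sInf ((fun β => FBP φ β) '' {β | InPolytope φ β}))) ≤
        permanent φ ∧
    (∏ i, ∏ j, if 0 < φ i j then (1 - φ i j) ^ (1 - φ i j) else 1) ≤
        Real.exp (-(sInf ((fun β => FBP φ β) '' {β | InPolytope φ β}))) := by
  have hself : InPolytope φ φ := ⟨hφ, fun _ _ h => h⟩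
  have hle : ∀ β, InPolytope φ β → Real.exp (-FBP φ β) ≤ permanent φ := fun β hβ => by
    rw [exp_neg_FBP φ β hφ.1 hβ]; exact bethe_le_perm φ β hφ.1 hβ.1
  have hpos : 0 < permanent φ := (Real.exp_pos _).trans_le (hle φ hself)
  have hlb : ∀ x ∈ (fun β => FBP φ β) '' {β | InPolytope φ β}, -Real.log (permanent φ) ≤ x := by
    rintro _ ⟨β, hβ, rfl⟩
    have := (Real.le_log_iff_exp_le hpos).mpr (hle β hβ)
    dsimp only
    linarith
  have hne : ((fun β => FBP φ β) '' {β | InPolytope φ β}).Nonempty := ⟨_, φ, hself, rfl⟩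
  constructor
  · rw [← Real.le_log_iff_exp_le hpos]
    have := le_csInf hne hlb
    linarith
  · have h1 : sInf ((fun β => FBP φ β) '' {β | InPolytope φ β}) ≤ FBP φ φ :=
      csInf_le ⟨_, hlb⟩ ⟨φ, hself, rfl⟩
    refine le_trans (le_of_eq ?_) (Real.exp_le_exp.mpr (neg_le_neg h1))
    rw [exp_neg_FBP φ φ hφ.1 hself]
    refine Finset.prod_congr rfl fun i _ => Finset.prod_congr rfl fun j _ => ?_
    split_ifs with h
    · rw [div_self h.ne', Real.one_rpow, one_mul]
    · have h0 : φ i j = 0 := le_antisymm (not_lt.mp h) (hφ.1 i j)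
      rw [h0]; simp
end

section
/- Let p be an n×n real matrix with nonnegative entries. Suppose β lies in the interior of the β-polytope 𝓑_p of p and solves the BP equations for p. Then perm(p) ≥ Z_BP(β|p) · ( ∏_{(i,j): p_ij>0} (1−β_ij)^{β_ij−1} ) · n!/n^n. -/
open scoped BigOperators

namespace VdW

open Polynomial in
lemma multiset_coeff {K : Type*} [Field K] (s : Multiset K) (h : (0:K) ∉ s) :
    ((s.map (fun a => X - C a)).prod).coeff 0 = (s.map (fun a => -a)).prod ∧
    ((s.map (fun a => X - C a)).prod).coeff 1 =
      (s.map (fun a => -a)).prod * (s.map (fun a => (-a)⁻¹)).sum := by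
  induction s using Multiset.induction_on with
  | empty => simp [Polynomial.coeff_one]
  | cons a s ih =>
    have ha : a ≠ 0 := fun e => h (by simp [e])
    obtain ⟨h0, h1⟩ := ih (fun e => h (by simp [e]))
    simp only [Multiset.map_cons, Multiset.prod_cons, Multiset.sum_cons]
    constructor
    · rw [Polynomial.mul_coeff_zero, h0]; simp
    · rw [sub_mul, Polynomial.coeff_sub, Polynomial.coeff_X_mul, Polynomial.coeff_C_mul, h0, h1]
      field_simp
      ring

open Polynomial in
lemma splits_coeff {K : Type*} [Field K] (R : K[X]) (hs : R.Splits) (h : (0:K) ∉ R.roots) :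
    R.coeff 1 = R.coeff 0 * (R.roots.map (fun a => (-a)⁻¹)).sum := by
  have e := hs.eq_prod_roots
  obtain ⟨h0, h1⟩ := multiset_coeff R.roots h
  have e0 : R.coeff 0 = R.leadingCoeff * (R.roots.map (fun a => -a)).prod := by
    rw [← h0, ← Polynomial.coeff_C_mul, ← e]
  have e1 : R.coeff 1 = R.leadingCoeff * ((R.roots.map (fun a => -a)).prod *
      (R.roots.map (fun a => (-a)⁻¹)).sum) := by
    rw [← h1, ← Polynomial.coeff_C_mul, ← e]
  rw [e0, e1, mul_assoc]

open Polynomial in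
/-- Complex step: a nonconstant polynomial with all roots in `Re < 0` has nonzero coefficient 1. -/
lemma coeff_one_ne (R : ℂ[X]) (hd : R.natDegree ≠ 0) (hr : ∀ t, 0 ≤ t.re → R.eval t ≠ 0) :
    R.coeff 1 ≠ 0 := by
  have hs : R.Splits := IsAlgClosed.splits R
  have hR : R ≠ 0 := by rintro rfl; simp at hd
  have hneg : ∀ a ∈ R.roots, a.re < 0 := by
    intro a ha
    by_contra hc
    push Not at hc
    exact hr a hc ((Polynomial.mem_roots hR).1 ha)
  have h0 : (0:ℂ) ∉ R.roots := fun e => by simpa using hneg 0 e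
  rw [splits_coeff R hs h0]
  refine mul_ne_zero ?_ ?_
  · rw [Polynomial.coeff_zero_eq_eval_zero]; exact hr 0 (by simp)
  · have hne : R.roots ≠ 0 := hs.roots_ne_zero hd
    have key : ∀ s : Multiset ℂ, (∀ a ∈ s, a.re < 0) →
        0 ≤ (s.map (fun a => (-a)⁻¹)).sum.re ∧
        (s ≠ 0 → 0 < (s.map (fun a => (-a)⁻¹)).sum.re) := by
      intro s
      induction s using Multiset.induction_on with
      | empty => simp
      | cons a s ih =>
        intro hs
        have ha := hs a (by simp)
        have := (ih (fun b hb => hs b (by simp [hb]))).1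
        have hp : 0 < ((-a)⁻¹).re := by
          rw [Complex.inv_re]
          apply div_pos
          · simpa using ha
          · rw [Complex.normSq_pos]; intro e; rw [neg_eq_zero] at e; simp [e] at ha
        simp only [Multiset.map_cons, Multiset.sum_cons, Complex.add_re]
        exact ⟨by linarith, fun _ => by linarith⟩
    intro e
    have := (key _ hneg).2 hne
    rw [e] at this
    simp at this

lemma amgm (s : Multiset ℝ) (hs : ∀ a ∈ s, a < 0) (t m : ℝ) (ht : 0 < t) (hm : 0 < m) :
    (s.map (fun a => t - a)).prod ≤ (s.map (fun a => -a)).prod * (m ^ (Multiset.card s) *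
      Real.exp ((t * (s.map (fun a => (-a)⁻¹)).sum - Multiset.card s * (m - 1)) / m)) ∧
    0 ≤ (s.map (fun a => t - a)).prod ∧ 0 < (s.map (fun a => -a)).prod := by
  induction s using Multiset.induction_on with
  | empty => simp
  | cons a s ih =>
    have ha := hs a (by simp)
    obtain ⟨h1, h2, h3⟩ := ih (fun b hb => hs b (by simp [hb]))
    simp only [Multiset.map_cons, Multiset.prod_cons, Multiset.sum_cons, Multiset.card_cons]
    refine ⟨?_, mul_nonneg (by linarith) h2, mul_pos (by linarith) h3⟩
    have hb : t - a ≤ (-a) * (m * Real.exp ((t * (-a)⁻¹ - (m - 1)) / m)) := by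
      have h := Real.add_one_le_exp ((t * (-a)⁻¹ - (m - 1)) / m)
      have e : t - a = (-a) * (m * ((t * (-a)⁻¹ - (m - 1)) / m + 1)) := by
        have : a ≠ 0 := ha.ne
        field_simp
        ring
      rw [e]
      have : 0 < -a := by linarith
      gcongr
    calc (t - a) * (s.map (fun a => t - a)).prod ≤ _ := mul_le_mul hb h1 h2 (by
            have : 0 < -a := by linarith
            positivity)
      _ = _ := by
        have : (t * ((-a)⁻¹ + (s.map (fun a => (-a)⁻¹)).sum) -
            ((Multiset.card s + 1 : ℕ) : ℝ) * (m - 1)) / m =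
            (t * (-a)⁻¹ - (m - 1)) / m +
            (t * (s.map (fun a => (-a)⁻¹)).sum - Multiset.card s * (m - 1)) / m := by
          push_cast; ring
        rw [this, Real.exp_add]
        ring

open Polynomial in
lemma uni (n : ℕ) (R : ℝ[X]) (hd : R.natDegree = n + 1) (A : ℝ) (hA : 0 < A)
    (hlow : ∀ t > 0, A * t ≤ R.eval t)
    (hroots : n ≠ 0 → ∀ t : ℂ, (R.map (algebraMap ℝ ℂ)).eval t = 0 → t.im = 0 ∧ t.re < 0) :
    (n / (n + 1 : ℝ)) ^ n * A ≤ R.coeff 1 := by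
  rcases Nat.eq_zero_or_pos n with rfl | hn
  · simp only [pow_zero, one_mul]
    have hev : ∀ t, R.eval t = R.coeff 0 + R.coeff 1 * t := by
      intro t
      rw [Polynomial.eval_eq_sum_range, hd]
      simp [Finset.sum_range_succ]
    by_contra hc
    push Not at hc
    have h := hlow ((|R.coeff 0| + 1) / (A - R.coeff 1)) (div_pos (by positivity) (by linarith))
    rw [hev] at h
    have h2 : (A - R.coeff 1) * ((|R.coeff 0| + 1) / (A - R.coeff 1)) = |R.coeff 0| + 1 := by
      rw [mul_div_cancel₀]; linarith
    have := le_abs_self (R.coeff 0)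
    linarith
  · have hR : R ≠ 0 := by rintro rfl; simp at hd
    have hroots := hroots hn.ne'
    have hs : R.Splits := by
      apply Polynomial.Splits.of_splits_map (algebraMap ℝ ℂ) (IsAlgClosed.splits _)
      intro a ha
      have h := hroots a (Polynomial.isRoot_of_mem_roots ha)
      exact ⟨a.re, by apply Complex.ext <;> simp [h.1]⟩
    have hneg : ∀ a ∈ R.roots, a < 0 := by
      intro a ha
      have h := hroots (a : ℂ) (by
        have : R.eval a = 0 := Polynomial.isRoot_of_mem_roots ha
        have e : (a : ℂ) = algebraMap ℝ ℂ a := rfl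
        rw [e, Polynomial.eval_map_algebraMap, Polynomial.aeval_algebraMap_apply]
        simp [this])
      simpa using h.2
    have h0 : (0:ℝ) ∉ R.roots := fun e => by simpa using hneg 0 e
    have hc1 := splits_coeff R hs h0
    have hcard : Multiset.card R.roots = n + 1 := by rw [← hs.natDegree_eq_card_roots, hd]
    set S := (R.roots.map (fun a => (-a)⁻¹)).sum with hS
    have hSpos : 0 < S := by
      have hne : R.roots ≠ 0 := by intro e; simp [e] at hcard
      rw [hS]
      have key : ∀ s : Multiset ℝ, (∀ a ∈ s, a < 0) →
          0 ≤ (s.map (fun a => (-a)⁻¹)).sum ∧ (s ≠ 0 → 0 < (s.map (fun a => (-a)⁻¹)).sum) := by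
        intro s
        induction s using Multiset.induction_on with
        | empty => simp
        | cons a s ih =>
          intro hs
          have ha := hs a (by simp)
          have := (ih (fun b hb => hs b (by simp [hb]))).1
          have hp : 0 < (-a)⁻¹ := inv_pos.2 (by linarith)
          simp only [Multiset.map_cons, Multiset.sum_cons]
          exact ⟨by linarith, fun _ => by linarith⟩
      exact (key _ hneg).2 hne
    have hn' : (0:ℝ) < n := by exact_mod_cast hn
    set m : ℝ := (n + 1) / n with hm
    have hmpos : 0 < m := by positivity
    set t : ℝ := m / S with ht
    have htpos : 0 < t := by positivity
    obtain ⟨h1, h2, h3⟩ := amgm R.roots hneg t m htpos hmpos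
    rw [hcard] at h1
    have hz : (t * S - ((n + 1 : ℕ) : ℝ) * (m - 1)) / m = 0 := by
      rw [ht, hm]; push_cast; field_simp; ring
    rw [← hS, hz, Real.exp_zero, mul_one] at h1
    have hev : R.eval t = R.leadingCoeff * (R.roots.map (fun a => t - a)).prod :=
      hs.eval_eq_prod_roots t
    have hlowt := hlow t htpos
    have hR0 : R.coeff 0 = R.leadingCoeff * (R.roots.map (fun a => -a)).prod := by
      rw [Polynomial.coeff_zero_eq_eval_zero, hs.eval_eq_prod_roots]
      simp
    have hlc : 0 ≤ R.leadingCoeff := by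
      by_contra hc
      push Not at hc
      have : R.eval t ≤ 0 := by rw [hev]; exact mul_nonpos_of_nonpos_of_nonneg hc.le h2
      have : 0 < A * t := by positivity
      linarith
    have hfin : A * t ≤ R.coeff 0 * m ^ (n + 1) := by
      calc A * t ≤ R.eval t := hlowt
        _ ≤ R.leadingCoeff * ((R.roots.map (fun a => -a)).prod * m ^ (n + 1)) := by
          rw [hev]; gcongr
        _ = _ := by rw [hR0]; ring
    have hinv : (n / (n + 1 : ℝ)) = m⁻¹ := by rw [hm]; field_simp
    rw [hc1, hinv, inv_pow]
    rw [inv_mul_le_iff₀ (by positivity)]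
    have e1 : A * m ≤ (R.coeff 0 * S * m ^ n) * m := by
      have : A * t * S = A * m := by rw [ht]; field_simp
      calc A * m = A * t * S := this.symm
        _ ≤ R.coeff 0 * m ^ (n + 1) * S := by gcongr
        _ = _ := by ring
    have := le_of_mul_le_mul_right e1 hmpos
    linarith

open MvPolynomial in
lemma aeval_cons {S : Type*} [CommRing S] [Algebra ℝ S] {n : ℕ} (z : Fin n → S) (t : S)
    (P : MvPolynomial (Fin (n+1)) ℝ) :
    aeval (Fin.cons t z : Fin (n+1) → S) P =
      Polynomial.eval t ((finSuccEquiv ℝ n P).map (aeval z : _ →ₐ[ℝ] S).toRingHom) := by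
  induction P using MvPolynomial.induction_on with
  | C a => simp [finSuccEquiv_apply]
  | add p q hp hq => simp only [map_add, Polynomial.map_add, Polynomial.eval_add, hp, hq]
  | mul_X p i hp =>
    simp only [map_mul, Polynomial.map_mul, Polynomial.eval_mul, hp]
    congr 1
    refine Fin.cases ?_ (fun j => ?_) i
    · simp [finSuccEquiv_X_zero]
    · simp [finSuccEquiv_X_succ]

open MvPolynomial in
lemma aeval_smul {n d : ℕ} (z : Fin n → ℂ) (w : ℂ)
    (P : MvPolynomial (Fin n) ℝ) (hP : P.IsHomogeneous d) :
    aeval (fun i => w * z i) P = w ^ d * aeval z P := by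
  rw [aeval_def, aeval_def, eval₂_eq', eval₂_eq', Finset.mul_sum]
  refine Finset.sum_congr rfl fun m hm => ?_
  have hdeg : ∑ i, m i = d := by
    have := hP.degree_eq_sum_deg_support hm
    rw [this]
    exact (Finset.sum_subset (Finset.subset_univ _) (fun i _ hi => by simpa using hi)).symm
  simp only [mul_pow, Finset.prod_mul_distrib, Finset.prod_pow_eq_pow_sum, hdeg]
  ring

/-- strict half-plane stability -/
def Stable {n : ℕ} (P : MvPolynomial (Fin n) ℝ) : Prop :=
  ∀ z : Fin n → ℂ, (∀ i, 0 ≤ (z i).re) → (∃ i, 0 < (z i).re) → MvPolynomial.aeval z P ≠ 0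

open MvPolynomial in
lemma lead {n : ℕ} (P : MvPolynomial (Fin (n+1)) ℝ) (hP : P.IsHomogeneous (n+1)) (hS : Stable P) :
    (finSuccEquiv ℝ n P).natDegree ≤ n + 1 ∧
      ∃ c : ℝ, c ≠ 0 ∧ (finSuccEquiv ℝ n P).coeff (n+1) = C c := by
  have h1 : (finSuccEquiv ℝ n P).natDegree ≤ n + 1 := by
    rw [natDegree_finSuccEquiv]
    exact (degreeOf_le_totalDegree _ _).trans hP.totalDegree_le
  refine ⟨h1, ?_⟩
  have hh := hP.finSuccEquiv_coeff_isHomogeneous (n+1) 0 rfl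
  have hc : (finSuccEquiv ℝ n P).coeff (n+1) = C (coeff 0 ((finSuccEquiv ℝ n P).coeff (n+1))) := by
    rw [← totalDegree_eq_zero_iff_eq_C]
    exact Nat.le_zero.1 hh.totalDegree_le
  refine ⟨_, ?_, hc⟩
  intro h0
  rw [h0] at hc
  refine hS (Fin.cons 1 0) ?_ ⟨0, by simp⟩ ?_
  · intro i
    refine Fin.cases ?_ (fun j => ?_) i <;> simp
  · rw [aeval_cons, Polynomial.eval_eq_sum_range' (n := n + 2)
      (lt_of_le_of_lt Polynomial.natDegree_map_le (by omega))]
    refine Finset.sum_eq_zero fun k hk => ?_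
    rw [Polynomial.coeff_map]
    rw [Finset.mem_range] at hk
    rcases Nat.lt_or_ge k (n+1) with hlt | hge
    · have hk := hP.finSuccEquiv_coeff_isHomogeneous k (n+1-k) (by omega)
      have e := aeval_smul (0 : Fin n → ℂ) 0 _ hk
      rw [zero_pow (by omega), zero_mul] at e
      have e2 : (fun i => (0:ℂ) * (0 : Fin n → ℂ) i) = 0 := by ext; simp
      rw [e2] at e
      simp only [AlgHom.toRingHom_eq_coe, RingHom.coe_coe, e, zero_mul]
    · obtain rfl : k = n + 1 := by omega
      rw [hc]; simp

open MvPolynomial in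
lemma natDeg {S : Type*} [Field S] [Algebra ℝ S] {n : ℕ} (P : MvPolynomial (Fin (n+1)) ℝ)
    (hP : P.IsHomogeneous (n+1)) (hS : Stable P) (z : Fin n → S) :
    ((finSuccEquiv ℝ n P).map (aeval z : _ →ₐ[ℝ] S).toRingHom).natDegree = n + 1 := by
  obtain ⟨h1, c, hc, h2⟩ := lead P hP hS
  apply le_antisymm (Polynomial.natDegree_map_le.trans h1)
  apply Polynomial.le_natDegree_of_ne_zero
  rw [Polynomial.coeff_map, h2]
  simp [hc]

open MvPolynomial in
lemma stable_step {n : ℕ} (P : MvPolynomial (Fin (n+1)) ℝ)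
    (hP : P.IsHomogeneous (n+1)) (hS : Stable P) : Stable ((finSuccEquiv ℝ n P).coeff 1) := by
  intro z hz hz'
  have := coeff_one_ne ((finSuccEquiv ℝ n P).map (aeval z : _ →ₐ[ℝ] ℂ).toRingHom)
    (by rw [natDeg P hP hS]; omega) (by
      intro t ht
      rw [← aeval_cons]
      apply hS
      · intro i
        refine Fin.cases ?_ (fun j => ?_) i
        · simpa using ht
        · simpa using hz j
      · obtain ⟨i, hi⟩ := hz'
        exact ⟨i.succ, by simpa using hi⟩)
  rw [Polynomial.coeff_map] at this
  exact this

open MvPolynomial in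
lemma step {n : ℕ} (P : MvPolynomial (Fin (n+1)) ℝ)
    (hP : P.IsHomogeneous (n+1)) (hS : Stable P) (A : ℝ) (hA : 0 < A)
    (hlow : ∀ x : Fin (n+1) → ℝ, (∀ i, 0 < x i) → A * ∏ i, x i ≤ aeval x P)
    (x : Fin n → ℝ) (hx : ∀ i, 0 < x i) :
    ((n / (n + 1 : ℝ)) ^ n * A) * ∏ i, x i ≤ aeval x ((finSuccEquiv ℝ n P).coeff 1) := by
  have hpr : 0 < ∏ i, x i := Finset.prod_pos fun i _ => hx i
  have := uni n ((finSuccEquiv ℝ n P).map (aeval x : _ →ₐ[ℝ] ℝ).toRingHom) (natDeg P hP hS x)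
    (A * ∏ i, x i) (by positivity) (by
      intro t ht
      rw [← aeval_cons]
      have := hlow (Fin.cons t x) (by
        intro i
        refine Fin.cases ?_ (fun j => ?_) i
        · simpa using ht
        · simpa using hx j)
      rw [Fin.prod_univ_succ] at this
      simp only [Fin.cons_zero, Fin.cons_succ] at this
      linarith) (by
      intro hn t ht
      have e : (((finSuccEquiv ℝ n P).map (aeval x : _ →ₐ[ℝ] ℝ).toRingHom).map (algebraMap ℝ ℂ)) =
          (finSuccEquiv ℝ n P).map (aeval (fun i => (x i : ℂ)) : _ →ₐ[ℝ] ℂ).toRingHom := by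
        rw [Polynomial.map_map]
        congr 1
        apply MvPolynomial.ringHom_ext
        · intro r; simp
        · intro i; simp
      rw [e, ← aeval_cons] at ht
      have i0 : Fin n := ⟨0, Nat.pos_of_ne_zero hn⟩
      have hre : t.re < 0 := by
        by_contra hc
        push Not at hc
        refine hS _ ?_ ⟨i0.succ, ?_⟩ ht
        · intro i
          refine Fin.cases ?_ (fun j => ?_) i
          · simpa using hc
          · simpa using (hx j).le
        · simpa using hx i0
      refine ⟨?_, hre⟩
      by_contra him
      set w : ℂ := ⟨1, t.re / t.im⟩ with hw
      have hsm := aeval_smul (Fin.cons t (fun i => (x i : ℂ)) : Fin (n+1) → ℂ) w P hP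
      rw [ht, mul_zero] at hsm
      refine hS _ ?_ ⟨i0.succ, ?_⟩ hsm
      · intro i
        refine Fin.cases ?_ (fun j => ?_) i
        · simp [hw]
          field_simp
          simp
        · simpa [hw] using (hx j).le
      · simpa [hw] using hx i0)
  rw [Polynomial.coeff_map] at this
  calc _ = (n / (n + 1 : ℝ)) ^ n * (A * ∏ i, x i) := by ring
    _ ≤ _ := this

open MvPolynomial in
theorem gurvits (n : ℕ) : ∀ (P : MvPolynomial (Fin n) ℝ), P.IsHomogeneous n → Stable P →
    ∀ A : ℝ, 0 < A → (∀ x : Fin n → ℝ, (∀ i, 0 < x i) → A * ∏ i, x i ≤ aeval x P) →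
    A * ((n.factorial : ℝ) / (n : ℝ) ^ n) ≤ coeff (Finsupp.equivFunOnFinite.symm (fun _ => 1)) P := by
  induction n with
  | zero =>
    intro P hP _ A hA hlow
    have h := hlow 0 (fun i => i.elim0)
    rw [MvPolynomial.eq_C_of_isEmpty P] at h
    have e : (Finsupp.equivFunOnFinite.symm (fun _ => 1) : Fin 0 →₀ ℕ) = 0 := by
      ext i; exact i.elim0
    rw [e]
    simpa using h
  | succ n ih =>
    intro P hP hS A hA hlow
    have hq := ih ((finSuccEquiv ℝ n P).coeff 1)
      (hP.finSuccEquiv_coeff_isHomogeneous 1 n (by omega)) (stable_step P hP hS)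
      ((n / (n + 1 : ℝ)) ^ n * A) (by
        rcases Nat.eq_zero_or_pos n with rfl | hn
        · simpa using hA
        · have : (0:ℝ) < n := by exact_mod_cast hn
          positivity) (step P hP hS A hA hlow)
    rw [finSuccEquiv_coeff_coeff] at hq
    have e : (Finsupp.cons 1 (Finsupp.equivFunOnFinite.symm (fun _ => 1) : Fin n →₀ ℕ)) =
        Finsupp.equivFunOnFinite.symm (fun _ => 1) := by
      ext i
      refine Fin.cases ?_ (fun j => ?_) i <;> simp
    rw [e] at hq
    refine le_trans (le_of_eq ?_) hq
    rw [Nat.factorial_succ]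
    rcases Nat.eq_zero_or_pos n with rfl | hn
    · simp
    · have : (0:ℝ) < n := by exact_mod_cast hn
      push_cast
      rw [div_pow, pow_succ ((n:ℝ) + 1) n]
      field_simp

open MvPolynomial in
lemma coeff_perm {n : ℕ} (p : Matrix (Fin n) (Fin n) ℝ) :
    coeff (Finsupp.equivFunOnFinite.symm (fun _ => 1))
      (∏ i, ∑ j, (C (p i j) * X j : MvPolynomial (Fin n) ℝ)) = permanent p := by
  classical
  rw [Finset.prod_univ_sum, Fintype.piFinset_univ, coeff_sum]
  have hterm : ∀ f : Fin n → Fin n,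
      coeff (Finsupp.equivFunOnFinite.symm (fun _ => 1))
        (∏ i, (C (p i (f i)) * X (f i) : MvPolynomial (Fin n) ℝ)) =
      if Function.Bijective f then ∏ i, p i (f i) else 0 := by
    intro f
    have e : (∏ i, (C (p i (f i)) * X (f i) : MvPolynomial (Fin n) ℝ)) =
        monomial (∑ i, Finsupp.single (f i) 1) (∏ i, p i (f i)) := by
      rw [monomial_sum_index, Finset.prod_mul_distrib, ← map_prod]
      rfl
    rw [e, coeff_monomial]
    congr 1
    apply propext
    constructor
    · intro h
      rw [← Finite.surjective_iff_bijective]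
      intro j
      by_contra hc
      push Not at hc
      have := DFunLike.congr_fun h j
      rw [Finsupp.finsetSum_apply] at this
      rw [Finset.sum_eq_zero (fun i _ => by rw [Finsupp.single_apply, if_neg (hc i)])] at this
      simp at this
    · intro h
      ext j
      rw [Finsupp.finsetSum_apply]
      obtain ⟨i, rfl⟩ := h.2 j
      rw [Finset.sum_eq_single i]
      · simp
      · intro b _ hb
        rw [Finsupp.single_apply, if_neg (fun e => hb (h.1 e))]
      · simp
  simp only [hterm]
  rw [← Finset.sum_filter]
  exact Finset.sum_bij (fun p h ↦ Equiv.ofBijective p (Finset.mem_filter.1 h).2)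
    (fun _ _ ↦ Finset.mem_univ _) (fun _ _ _ _ h ↦ by injection h)
    (fun b _ ↦ ⟨b, Finset.mem_filter.2 ⟨Finset.mem_univ _, b.bijective⟩, Equiv.ext fun _ => rfl⟩)
    fun _ _ ↦ rfl

open MvPolynomial in
lemma perm_pos {n : ℕ} (p : Matrix (Fin n) (Fin n) ℝ) (hp : ∀ i j, 0 < p i j)
    (A : ℝ) (hA : 0 < A)
    (hlow : ∀ x : Fin n → ℝ, (∀ i, 0 < x i) → A * ∏ i, x i ≤ ∏ i, ∑ j, p i j * x j) :
    A * ((n.factorial : ℝ) / (n : ℝ) ^ n) ≤ permanent p := by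
  rw [← coeff_perm]
  refine gurvits n _ ?_ ?_ A hA ?_
  · have := MvPolynomial.IsHomogeneous.prod Finset.univ
      (fun i => ∑ j, (C (p i j) * X j : MvPolynomial (Fin n) ℝ)) (fun _ => 1)
      (fun i _ => MvPolynomial.IsHomogeneous.sum _ _ _ fun j _ => isHomogeneous_C_mul_X _ _)
    simpa using this
  · intro z hz hz'
    simp only [map_prod, map_sum, map_mul, aeval_C, aeval_X]
    rw [Finset.prod_ne_zero_iff]
    intro i _ h
    have h := congrArg Complex.re h
    rw [Complex.re_sum] at h
    obtain ⟨k, hk⟩ := hz'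
    have : 0 < ∑ j, ((algebraMap ℝ ℂ) (p i j) * z j).re := by
      apply Finset.sum_pos'
      · intro j _
        simpa using mul_nonneg (hp i j).le (hz j)
      · exact ⟨k, Finset.mem_univ _, by simpa using mul_pos (hp i k) hk⟩
    rw [h] at this
    simp at this
  · intro x hx
    simpa only [map_prod, map_sum, map_mul, aeval_C, aeval_X, Algebra.algebraMap_self,
      RingHom.id_apply] using hlow x hx

lemma perm_nonneg {n : ℕ} (p : Matrix (Fin n) (Fin n) ℝ) (hp : ∀ i j, 0 ≤ p i j)
    (A : ℝ) (hA : 0 < A)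
    (hlow : ∀ x : Fin n → ℝ, (∀ i, 0 < x i) → A * ∏ i, x i ≤ ∏ i, ∑ j, p i j * x j) :
    A * ((n.factorial : ℝ) / (n : ℝ) ^ n) ≤ permanent p := by
  have hc : Continuous (fun ε : ℝ => permanent (fun i j => p i j + ε)) := by
    unfold permanent
    fun_prop
  have hlim : Filter.Tendsto (fun ε : ℝ => permanent (fun i j => p i j + ε))
      (nhdsWithin 0 (Set.Ioi 0)) (nhds (permanent p)) := by
    have := (hc.tendsto 0).mono_left (nhdsWithin_le_nhds (s := Set.Ioi 0))
    simpa using this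
  refine ge_of_tendsto hlim ?_
  filter_upwards [self_mem_nhdsWithin] with ε hε
  have hε : 0 < ε := hε
  refine perm_pos _ (fun i j => by have := hp i j; linarith) A hA ?_
  intro x hx
  refine (hlow x hx).trans ?_
  apply Finset.prod_le_prod
  · intro i _
    exact Finset.sum_nonneg fun j _ => mul_nonneg (hp i j) (hx j).le
  · intro i _
    apply Finset.sum_le_sum
    intro j _
    have := hx j
    gcongr
    linarith

end VdW

theorem BP_lower_bound_vdW {n : ℕ} (p β : Matrix (Fin n) (Fin n) ℝ)
    (hp : ∀ i j, 0 ≤ p i j) (hβ : InInterior p β)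
    (hBP : ∃ u v : Fin n → ℝ, (∀ i, 0 < u i) ∧ (∀ j, 0 < v j) ∧
      ∀ i j, β i j * (1 - β i j) = p i j / (u i * v j)) :
    Real.exp (-(FBP p β)) *
      (∏ i, ∏ j, if 0 < p i j then (1 - β i j) ^ (β i j - 1) else 1) *
      ((n.factorial : ℝ) / (n : ℝ) ^ n) ≤ permanent p := by
  obtain ⟨⟨⟨hβ0, hrow, hcol⟩, hsupp⟩, hint⟩ := hβ
  have hcase : ∀ i j, (p i j = 0 ∧ β i j = 0) ∨ (0 < p i j ∧ 0 < β i j ∧ β i j < 1) := by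
    intro i j
    rcases (hp i j).eq_or_lt with h | h
    · exact Or.inl ⟨h.symm, hsupp i j h.symm⟩
    · exact Or.inr ⟨h, hint i j h⟩
  have hpos : ∀ i j, 0 < (p i j / β i j) ^ β i j := by
    intro i j
    rcases hcase i j with ⟨h1, h2⟩ | ⟨h1, h2, h3⟩
    · simp [h2]
    · positivity
  have hL : Real.exp (-(FBP p β)) *
      (∏ i, ∏ j, if 0 < p i j then (1 - β i j) ^ (β i j - 1) else 1) =
      ∏ i, ∏ j, (p i j / β i j) ^ β i j := by
    unfold FBP
    simp only [← Finset.sum_neg_distrib, Real.exp_sum]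
    rw [← Finset.prod_mul_distrib]
    refine Finset.prod_congr rfl fun i _ => ?_
    rw [← Finset.prod_mul_distrib]
    refine Finset.prod_congr rfl fun j _ => ?_
    rcases hcase i j with ⟨h1, h2⟩ | ⟨h1, h2, h3⟩
    · simp [h1, h2]
    · have h4 : 0 < 1 - β i j := by linarith
      rw [if_pos h1, if_pos h1, Real.rpow_def_of_pos h4, Real.rpow_def_of_pos (by positivity),
        ← Real.exp_add, Real.log_div h2.ne' h1.ne', Real.log_div h1.ne' h2.ne']
      congr 1
      ring
  rw [hL]
  refine VdW.perm_nonneg p hp _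
    (Finset.prod_pos fun i _ => Finset.prod_pos fun j _ => hpos i j) ?_
  intro x hx
  have e : (∏ i, ∏ j, (p i j / β i j) ^ β i j) * ∏ j, x j =
      ∏ i, ∏ j, (p i j / β i j * x j) ^ β i j := by
    have e1 : ∏ j, x j = ∏ i, ∏ j, x j ^ β i j := by
      rw [Finset.prod_comm]
      refine Finset.prod_congr rfl fun j _ => ?_
      rw [← Real.rpow_sum_of_pos (hx j), hcol j, Real.rpow_one]
    rw [e1, ← Finset.prod_mul_distrib]
    refine Finset.prod_congr rfl fun i _ => ?_
    rw [← Finset.prod_mul_distrib]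
    refine Finset.prod_congr rfl fun j _ => ?_
    rw [Real.mul_rpow (div_nonneg (hp i j) (hβ0 i j)) (hx j).le]
  rw [e]
  have hnn : ∀ i j, 0 ≤ p i j / β i j * x j := fun i j =>
    mul_nonneg (div_nonneg (hp i j) (hβ0 i j)) (hx j).le
  apply Finset.prod_le_prod
  · intro i _
    exact Finset.prod_nonneg fun j _ => Real.rpow_nonneg (hnn i j) _
  · intro i _
    refine (Real.geom_mean_le_arith_mean_weighted Finset.univ (fun j => β i j)
      (fun j => p i j / β i j * x j) (fun j _ => hβ0 i j) (hrow i) (fun j _ => hnn i j)).trans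
      (le_of_eq ?_)
    refine Finset.sum_congr rfl fun j _ => ?_
    rcases hcase i j with ⟨h1, h2⟩ | ⟨h1, h2, h3⟩
    · simp [h1, h2]
    · field_simp
end

section
/- Let β be an n×n doubly stochastic real matrix with β_ij < 1 for all i,j, and let γ ∈ [−1,1]. Then perm(C) ≥ (n!/n^n) · ∏_{i,j} (1−β_ij)^{−γ·β_ij}, where C is the n×n matrix with entries C_ij = β_ij·(1−β_ij)^{−γ}. -/
open scoped BigOperators

section Gurvits
open Polynomial

lemma prod_one_add_le_aux (S : ℝ) (hS : 0 < S) (s : Multiset ℝ) (hs : ∀ u ∈ s, 0 ≤ u) :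
    (s.map (fun u => 1 + u)).prod ≤
      S ^ s.card * Real.exp ((s.card + s.sum) / S - s.card) := by
  induction s using Multiset.induction_on with
  | empty => simp
  | cons u s ih =>
    have ih' := ih (fun v hv => hs v (Multiset.mem_cons_of_mem hv))
    have hu := hs u (Multiset.mem_cons_self u s)
    have h1 : 1 + u ≤ S * Real.exp ((1 + u) / S - 1) := by
      have := Real.add_one_le_exp ((1 + u) / S - 1)
      calc 1 + u = S * ((1 + u) / S - 1 + 1) := by field_simp; ring
        _ ≤ _ := by gcongr
    have h0 : 0 ≤ (s.map (fun u => 1 + u)).prod := by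
      apply Multiset.prod_nonneg
      intro a ha
      obtain ⟨v, hv, rfl⟩ := Multiset.mem_map.1 ha
      have := hs v (Multiset.mem_cons_of_mem hv)
      linarith
    simp only [Multiset.map_cons, Multiset.prod_cons, Multiset.card_cons, Multiset.sum_cons]
    calc _ ≤ (S * Real.exp ((1 + u) / S - 1)) *
          (S ^ s.card * Real.exp ((s.card + s.sum) / S - s.card)) := by
            apply mul_le_mul h1 ih' h0; positivity
      _ = S ^ (s.card + 1) * (Real.exp ((1 + u) / S - 1) *
            Real.exp ((s.card + s.sum) / S - s.card)) := by ring
      _ = _ := by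
        rw [← Real.exp_add]
        congr 2
        push_cast
        ring

lemma prod_one_add_le (s : Multiset ℝ) (hs : ∀ u ∈ s, 0 ≤ u) (hc : 0 < s.card) :
    (s.map (fun u => 1 + u)).prod ≤ (1 + s.sum / s.card) ^ s.card := by
  have h0 : 0 ≤ s.sum := Multiset.sum_nonneg hs
  have hc' : (0 : ℝ) < s.card := by exact_mod_cast hc
  have hS : 0 < 1 + s.sum / s.card := by positivity
  refine (prod_one_add_le_aux _ hS s hs).trans (le_of_eq ?_)
  have : ((s.card : ℝ) + s.sum) / (1 + s.sum / s.card) - s.card = 0 := by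
    field_simp
    ring
  rw [this]; simp

/-- Polynomials with only negative real roots. -/
lemma real_rooted_bound (R : ℝ[X]) (m : ℕ) (hm : 0 < m) (hdeg : R.natDegree = m)
    (h0 : 0 < R.eval 0)
    (hroots : ∀ z : ℂ, aeval z R = 0 → ∃ r : ℝ, r < 0 ∧ (r : ℂ) = z) :
    0 < (derivative R).eval 0 ∧ ∀ t : ℝ, 0 ≤ t →
      R.eval t ≤ R.eval 0 * (1 + t * ((derivative R).eval 0 / R.eval 0) / m) ^ m := by
  have hR : R ≠ 0 := by rintro rfl; simp at h0
  have hsp : R.Splits := by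
    apply Splits.of_splits_map (algebraMap ℝ ℂ) (IsAlgClosed.splits _)
    intro a ha
    rw [mem_roots (by simpa [Polynomial.map_eq_zero] using hR)] at ha
    obtain ⟨r, _, h⟩ := hroots a (by simpa [IsRoot, eval_map_algebraMap] using ha)
    exact ⟨r, h⟩
  have hneg : ∀ r ∈ R.roots, r < 0 := by
    intro r hr
    rw [mem_roots hR] at hr
    obtain ⟨r', h, h'⟩ := hroots (r : ℂ) (by
      have := aeval_algebraMap_apply ℂ r R
      simp only [Complex.coe_algebraMap] at this
      rw [this, coe_aeval_eq_eval, hr.eq_zero]; simp)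
    have : r' = r := by exact_mod_cast h'
    rwa [← this]
  have hcard : R.roots.card = m := by rw [← hdeg]; exact hsp.natDegree_eq_card_roots.symm
  set s : Multiset ℝ := R.roots.map (fun z => 1 / (0 - z)) with hs
  have hspos : ∀ u ∈ s, 0 < u := by
    intro u hu
    obtain ⟨r, hr, rfl⟩ := Multiset.mem_map.1 hu
    have := hneg r hr
    apply one_div_pos.2; linarith
  have hscard : s.card = m := by simp [hs, hcard]
  have hd : (derivative R).eval 0 / R.eval 0 = s.sum :=
    hsp.eval_derivative_div_eval_of_ne_zero h0.ne'
  have hsum : 0 < s.sum := by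
    obtain ⟨u, hu⟩ := Multiset.card_pos_iff_exists_mem.1 (hscard ▸ hm)
    exact (hspos u hu).trans_le (Multiset.single_le_sum (fun x hx => (hspos x hx).le) u hu)
  refine ⟨?_, ?_⟩
  · have := (div_eq_iff h0.ne').1 hd
    rw [this]; positivity
  · intro t ht
    rw [hd]
    have key := prod_one_add_le (s.map (fun u => t * u)) (by
      intro u hu
      obtain ⟨v, hv, rfl⟩ := Multiset.mem_map.1 hu
      have := hspos v hv
      positivity) (by simp [hscard, hm])
    rw [Multiset.sum_map_mul_left, Multiset.card_map, hscard, Multiset.map_map] at key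
    simp only [Multiset.map_id'] at key
    have heq : R.eval t = R.eval 0 * (s.map ((fun u => 1 + u) ∘ fun u => t * u)).prod := by
      rw [hsp.eval_eq_prod_roots, hsp.eval_eq_prod_roots, hs, Multiset.map_map, mul_assoc,
        ← Multiset.prod_map_mul]
      congr 2
      apply Multiset.map_congr rfl
      intro r hr
      have := (hneg r hr).ne
      simp only [Function.comp]
      field_simp
      ring
    rw [heq]
    gcongr

end Gurvits


section Gurvits2
set_option linter.unusedSectionVars false
open MvPolynomial
variable {ι : Type*} [Fintype ι]

/-- Restriction of `q` to the line `y + t a`. -/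
noncomputable def lineRestr {K : Type*} [Field K] [Algebra ℝ K] (y a : ι → K)
    (q : MvPolynomial ι ℝ) : Polynomial K :=
  aeval (fun i => Polynomial.C (y i) + Polynomial.C (a i) * Polynomial.X) q

/-- Directional derivative. -/
noncomputable def dirDeriv (a : ι → ℝ) (q : MvPolynomial ι ℝ) : MvPolynomial ι ℝ :=
  ∑ i, C (a i) * pderiv i q

lemma eval_lineRestr {K : Type*} [Field K] [Algebra ℝ K] (y a : ι → K)
    (q : MvPolynomial ι ℝ) (t : K) :
    (lineRestr y a q).eval t = aeval (fun i => y i + a i * t) q := by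
  unfold lineRestr
  induction q using MvPolynomial.induction_on with
  | C r => simp [Polynomial.algebraMap_apply]
  | add p q hp hq => simp [hp, hq]
  | mul_X p i hp => simp [hp]

lemma dirDeriv_mul (a : ι → ℝ) (p q : MvPolynomial ι ℝ) :
    dirDeriv a (p * q) = dirDeriv a p * q + p * dirDeriv a q := by
  unfold dirDeriv
  rw [Finset.sum_mul, Finset.mul_sum, ← Finset.sum_add_distrib]
  apply Finset.sum_congr rfl
  intro i _
  rw [pderiv_mul]; ring

lemma dirDeriv_X (a : ι → ℝ) (i : ι) : dirDeriv a (X i) = C (a i) := by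
  unfold dirDeriv
  rw [Finset.sum_eq_single i]
  · simp
  · intro b _ hb
    rw [pderiv_X_of_ne hb.symm, mul_zero]
  · simp

lemma dirDeriv_add (a : ι → ℝ) (p q : MvPolynomial ι ℝ) :
    dirDeriv a (p + q) = dirDeriv a p + dirDeriv a q := by
  simp [dirDeriv, mul_add, Finset.sum_add_distrib]

lemma derivative_lineRestr {K : Type*} [Field K] [Algebra ℝ K] (y : ι → K) (a : ι → ℝ)
    (q : MvPolynomial ι ℝ) :
    Polynomial.derivative (lineRestr y (fun i => algebraMap ℝ K (a i)) q) =
      lineRestr y (fun i => algebraMap ℝ K (a i)) (dirDeriv a q) := by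
  induction q using MvPolynomial.induction_on with
  | C r => simp [lineRestr, dirDeriv, Polynomial.algebraMap_apply]
  | add p q hp hq =>
    rw [dirDeriv_add]
    simp only [lineRestr, map_add] at *
    rw [hp, hq]
  | mul_X p i hp =>
    rw [dirDeriv_mul, dirDeriv_X]
    simp only [lineRestr, map_add, map_mul, Polynomial.derivative_mul] at *
    rw [hp]
    simp [Polynomial.algebraMap_apply]

lemma isHomogeneous_dirDeriv (a : ι → ℝ) (q : MvPolynomial ι ℝ) (m : ℕ)
    (hq : q.IsHomogeneous (m + 1)) : (dirDeriv a q).IsHomogeneous m := by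
  unfold dirDeriv
  apply IsHomogeneous.sum
  intro i _
  apply IsHomogeneous.C_mul
  intro d hd
  rw [coeff_pderiv] at hd
  have := hq (left_ne_zero_of_mul hd)
  simp only [map_add, Finsupp.weight_single] at this
  simpa using this

lemma coeff_lineRestr {K : Type*} [Field K] [Algebra ℝ K] (y a : ι → K) (ha : ∀ i, a i ≠ 0)
    (q : MvPolynomial ι ℝ) (m : ℕ) (hq : q.IsHomogeneous m) :
    (lineRestr y a q).natDegree ≤ m ∧ (lineRestr y a q).coeff m = aeval a q := by
  have hlin : ∀ i, (Polynomial.C (y i) + Polynomial.C (a i) * Polynomial.X).natDegree = 1 := by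
    intro i
    rw [add_comm]; exact Polynomial.natDegree_linear (ha i)
  have hlead : ∀ i, (Polynomial.C (y i) + Polynomial.C (a i) * Polynomial.X).leadingCoeff = a i := by
    intro i
    rw [add_comm]; exact Polynomial.leadingCoeff_linear (ha i)
  have hmon : ∀ d ∈ q.support,
      (∏ i, (Polynomial.C (y i) + Polynomial.C (a i) * Polynomial.X) ^ d i).natDegree = m ∧
      (∏ i, (Polynomial.C (y i) + Polynomial.C (a i) * Polynomial.X) ^ d i).coeff m
        = ∏ i, a i ^ d i := by
    intro d hd
    have hdeg : (∏ i, (Polynomial.C (y i) + Polynomial.C (a i) * Polynomial.X) ^ d i).natDegree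
        = m := by
      rw [Polynomial.natDegree_prod]
      · simp only [Polynomial.natDegree_pow, hlin, mul_one]
        have := hq (mem_support_iff.1 hd)
        rw [← this, Finsupp.weight_apply, Finsupp.sum_fintype] <;> simp
      · intro i _
        apply pow_ne_zero
        intro h
        have := hlin i
        rw [h] at this
        simp at this
    refine ⟨hdeg, ?_⟩
    conv_lhs => rw [← hdeg]
    rw [Polynomial.coeff_natDegree, Polynomial.leadingCoeff_prod]
    simp [hlead]
  constructor
  · unfold lineRestr
    rw [aeval_def, eval₂_eq']
    apply Polynomial.natDegree_sum_le_of_forall_le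
    intro d hd
    rw [Polynomial.algebraMap_apply]
    refine (Polynomial.natDegree_C_mul_le _ _).trans (hmon d hd).1.le
  · unfold lineRestr
    rw [aeval_def, eval₂_eq', aeval_def, eval₂_eq', Polynomial.finsetSum_coeff]
    apply Finset.sum_congr rfl
    intro d hd
    rw [Polynomial.algebraMap_apply, Polynomial.coeff_C_mul, (hmon d hd).2]

lemma homogeneous_aeval_smul {K : Type*} [Field K] [Algebra ℝ K] (c : K) (a : ι → K)
    (q : MvPolynomial ι ℝ) (m : ℕ) (hq : q.IsHomogeneous m) :
    aeval (fun i => c * a i) q = c ^ m * aeval a q := by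
  rw [aeval_def, eval₂_eq', aeval_def, eval₂_eq', Finset.mul_sum]
  apply Finset.sum_congr rfl
  intro d hd
  have := hq (mem_support_iff.1 hd)
  rw [Finsupp.weight_apply, Finsupp.sum_fintype] at this
  · simp only [Pi.one_apply, smul_eq_mul, mul_one] at this
    simp only [mul_pow, Finset.prod_mul_distrib]
    rw [Finset.prod_pow_eq_pow_sum, this]
    ring
  · simp

/-- Stable, homogeneous, positive. -/
structure GoodPoly (m : ℕ) (q : MvPolynomial ι ℝ) : Prop where
  hom : q.IsHomogeneous m
  stable : ∀ z : ι → ℂ, (∀ i, 0 < (z i).im) → aeval z q ≠ 0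
  pos : ∀ y : ι → ℝ, (∀ i, 0 < y i) → 0 < eval y q

lemma aeval_eq_eval_real (y : ι → ℝ) (q : MvPolynomial ι ℝ) : aeval y q = eval y q := rfl

lemma aeval_real (y : ι → ℝ) (q : MvPolynomial ι ℝ) :
    aeval (fun i => (y i : ℂ)) q = ((eval y q : ℝ) : ℂ) := by
  have := MvPolynomial.aeval_algebraMap_apply ℂ y q
  simpa [Function.comp_def, MvPolynomial.coe_aeval_eq_eval] using this

lemma lineRestr_map (y a : ι → ℝ) (q : MvPolynomial ι ℝ) (z : ℂ) :
    Polynomial.aeval z (lineRestr y a q) = aeval (fun i => (y i : ℂ) + a i * z) q := by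
  unfold lineRestr
  induction q using MvPolynomial.induction_on with
  | C r => simp 
  | add p q hp hq => simp [hp, hq]
  | mul_X p i hp => simp [hp]


lemma lineRestr_natDegree {K : Type*} [Field K] [Algebra ℝ K] (y a : ι → K) (ha : ∀ i, a i ≠ 0)
    (q : MvPolynomial ι ℝ) (m : ℕ) (hq : q.IsHomogeneous m) (h : aeval a q ≠ 0) :
    (lineRestr y a q).natDegree = m := by
  obtain ⟨h1, h2⟩ := coeff_lineRestr y a ha q m hq
  apply le_antisymm h1
  apply Polynomial.le_natDegree_of_ne_zero
  rwa [h2]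

lemma GoodPoly.real_line {m : ℕ} {q : MvPolynomial ι ℝ} (hq : GoodPoly (m + 1) q)
    (y a : ι → ℝ) (hy : ∀ i, 0 < y i) (ha : ∀ i, 0 < a i) :
    0 < eval y (dirDeriv a q) ∧ ∀ t : ℝ, 0 ≤ t →
      eval (fun i => y i + a i * t) q ≤ eval y q *
        (1 + t * (eval y (dirDeriv a q) / eval y q) / ((m + 1 : ℕ) : ℝ)) ^ (m + 1) := by
  have e0 : ∀ t, (lineRestr y a q).eval t = eval (fun i => y i + a i * t) q := by
    intro t
    rw [eval_lineRestr, aeval_eq_eval_real]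
  have e1 : (lineRestr y a q).eval 0 = eval y q := by rw [e0]; simp
  have e2 : (Polynomial.derivative (lineRestr y a q)).eval 0 = eval y (dirDeriv a q) := by
    have := derivative_lineRestr (K := ℝ) y a q
    simp only [Algebra.algebraMap_self, RingHom.id_apply] at this
    rw [this, eval_lineRestr, aeval_eq_eval_real]; simp
  have hpos := hq.pos y hy
  have := real_rooted_bound (lineRestr y a q) (m + 1) (Nat.succ_pos m)
    (lineRestr_natDegree y a (fun i => (ha i).ne') q _ hq.hom (by
      rw [aeval_eq_eval_real]; exact (hq.pos a ha).ne'))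
    (by rw [e1]; exact hpos) (by
      intro z hz
      rw [lineRestr_map] at hz
      rcases lt_trichotomy z.im 0 with h | h | h
      · exfalso
        have h2 := homogeneous_aeval_smul (-1 : ℂ) (fun i => (y i : ℂ) + a i * z) q _ hq.hom
        rw [hz, mul_zero] at h2
        refine hq.stable _ ?_ h2
        intro i
        have := mul_neg_of_pos_of_neg (ha i) h
        simpa using this
      · refine ⟨z.re, ?_, Complex.ext rfl (by simp [h])⟩
        by_contra hre
        push Not at hre
        have hz' : z = (z.re : ℂ) := Complex.ext rfl (by simp [h])
        rw [hz'] at hz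
        have h3 := aeval_real (fun i => y i + a i * z.re) q
        push_cast at h3
        rw [h3] at hz
        have h4 := hq.pos (fun i => y i + a i * z.re) (fun i => by
          have := hy i; have := ha i; positivity)
        exact h4.ne' (by exact_mod_cast hz)
      · exfalso
        refine hq.stable _ ?_ hz
        intro i
        have := mul_pos (ha i) h
        simpa using this)
  rw [e1, e2] at this
  refine ⟨this.1, fun t ht => ?_⟩
  have h5 := this.2 t ht
  rwa [e0] at h5

lemma GoodPoly.dirDeriv {m : ℕ} {q : MvPolynomial ι ℝ} (hq : GoodPoly (m + 1) q)
    (a : ι → ℝ) (ha : ∀ i, 0 < a i) : GoodPoly m (dirDeriv a q) where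
  hom := isHomogeneous_dirDeriv a q m hq.hom
  pos := fun y hy => (hq.real_line y a hy ha).1
  stable := by
    intro z hz h0
    set g := lineRestr z (fun i => algebraMap ℝ ℂ (a i)) q with hg
    have hdeg : g.natDegree = m + 1 := by
      apply lineRestr_natDegree _ _ _ _ _ hq.hom
      · have := aeval_real a q
        simp only [Complex.coe_algebraMap]
        rw [this]
        exact_mod_cast (hq.pos a ha).ne'
      · intro i
        simpa using (ha i).ne'
    have hd : g.derivative.eval 0 = 0 := by
      rw [hg, derivative_lineRestr, eval_lineRestr]
      simpa using h0
    have hne : g.derivative ≠ 0 := by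
      intro h
      have := Polynomial.derivative_eq_zero.1 h
      omega
    have hmem : (0 : ℂ) ∈ g.derivative.rootSet ℂ := by
      rw [Polynomial.mem_rootSet]
      exact ⟨hne, by simpa [Polynomial.coe_aeval_eq_eval] using hd⟩
    have hsub := Polynomial.rootSet_derivative_subset_convexHull_rootSet
      (P := g) (Polynomial.natDegree_pos_iff_degree_pos.1 (by omega)) hmem
    have hconv : Convex ℝ {w : ℂ | w.im < 0} := convex_halfSpace_im_lt 0
    have hroots : g.rootSet ℂ ⊆ {w : ℂ | w.im < 0} := by
      intro w hw
      rw [Polynomial.mem_rootSet, Polynomial.coe_aeval_eq_eval, hg, eval_lineRestr] at hw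
      by_contra hw'
      simp only [Set.mem_ofPred_eq, not_lt] at hw'
      refine hq.stable _ ?_ hw.2
      intro i
      have := mul_nonneg (ha i).le hw'
      have := hz i
      simp
      linarith
    have := convexHull_min hroots hconv hsub
    simp at this

/-- Iterated directional derivatives. -/
noncomputable def iterDeriv : (m : ℕ) → (Fin m → ι → ℝ) → MvPolynomial ι ℝ → MvPolynomial ι ℝ
  | 0, _, q => q
  | m + 1, a, q => iterDeriv m (fun j => a j.succ) (dirDeriv (a 0) q)

lemma factor_step (m : ℕ) : (((m + 1).factorial : ℝ) / ((m + 1 : ℕ) : ℝ) ^ (m + 1)) =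
    ((m.factorial : ℝ) / (m : ℝ) ^ m) * ((m : ℝ) / ((m + 1 : ℕ) : ℝ)) ^ m := by
  rw [Nat.factorial_succ, div_pow, pow_succ]
  have h1 : ((m : ℝ)) ^ m ≠ 0 := by
    rcases Nat.eq_zero_or_pos m with rfl | h
    · simp
    · positivity
  push_cast
  have h2 : (m : ℝ) + 1 ≠ 0 := by positivity
  field_simp

theorem gurvits (m : ℕ) : ∀ (q : MvPolynomial ι ℝ) (a : Fin m → ι → ℝ) (_ : ∀ j i, 0 < a j i)
    (_ : GoodPoly m q) (K : ℝ) (_ : ∀ x : Fin m → ℝ, (∀ j, 0 < x j) →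
      K * ∏ j, x j ≤ eval (fun i => ∑ j, x j * a j i) q),
    ((m.factorial : ℝ) / (m : ℝ) ^ m) * K ≤ eval 0 (iterDeriv m a q) := by
  induction m with
  | zero =>
    intro q a ha hq K hK
    have := hK (fun _ => 1) (by simp)
    simpa [iterDeriv, Pi.zero_def] using this
  | succ m ih =>
    intro q a ha hq K hK
    rw [factor_step, mul_assoc]
    apply ih _ _ (fun j i => ha _ _) (hq.dirDeriv (a 0) (ha 0))
    intro x hx
    rcases Nat.eq_zero_or_pos m with rfl | hm
    · simp only [pow_zero, one_mul, Finset.univ_eq_empty, Finset.prod_empty, Finset.sum_empty,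
        mul_one]
      have h1 := hK (fun _ => 1) (by simp)
      simp only [Finset.prod_const_one, mul_one, one_mul, Fin.sum_univ_succ, Finset.univ_eq_empty,
        Finset.sum_empty, add_zero] at h1
      refine h1.trans (le_of_eq ?_)
      have h2 := coeff_lineRestr (K := ℝ) 0 (a 0) (fun i => (ha 0 i).ne') q 1 hq.hom
      have h3 := derivative_lineRestr (K := ℝ) 0 (a 0) q
      simp only [Algebra.algebraMap_self, RingHom.id_apply] at h3
      have h4 := congrArg (Polynomial.eval 0) h3
      rw [eval_lineRestr, aeval_eq_eval_real, ← Polynomial.coeff_zero_eq_eval_zero,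
        Polynomial.coeff_derivative] at h4
      have h5 := h2.2
      rw [aeval_eq_eval_real] at h5
      refine h5.symm.trans ?_
      simpa using h4
    · set y : ι → ℝ := fun i => ∑ j, x j * a j.succ i with hy
      have hypos : ∀ i, 0 < y i := by
        intro i
        apply Finset.sum_pos
        · intro j _
          exact mul_pos (hx j) (ha _ _)
        · exact ⟨⟨0, hm⟩, Finset.mem_univ _⟩
      obtain ⟨hd, hb⟩ := hq.real_line y (a 0) hypos (ha 0)
      have hp := hq.pos y hypos
      set A := eval y q
      set B := eval y (_root_.dirDeriv (a 0) q)
      have hm' : (0 : ℝ) < m := by exact_mod_cast hm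
      set t : ℝ := (m + 1) * A / (m * B) with ht
      have htpos : 0 < t := by positivity
      have h1 := hb t htpos.le
      have h2 := hK (Fin.cons t x) (by
        intro j
        refine Fin.cases ?_ ?_ j
        · simpa using htpos
        · intro j; simpa using hx j)
      simp only [Fin.sum_univ_succ, Fin.prod_univ_succ, Fin.cons_zero, Fin.cons_succ] at h2
      have h3 : (fun i => t * a 0 i + ∑ j, x j * a j.succ i) = fun i => y i + a 0 i * t := by
        funext i
        rw [hy]; ring
      rw [h3] at h2
      have h4 := h2.trans h1
      have h5 : 1 + t * (B / A) / ((m + 1 : ℕ) : ℝ) = ((m : ℝ) + 1) / m := by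
        rw [ht]; push_cast; field_simp
      rw [h5] at h4
      set P := ∏ j, x j
      have h6 : K * P * t ≤ A * (((m : ℝ) + 1) / m) ^ (m + 1) := by linarith
      have h7 : K * P ≤ B * (((m : ℝ) + 1) / m) ^ m := by
        have : A * (((m : ℝ) + 1) / m) ^ (m + 1) = (B * (((m : ℝ) + 1) / m) ^ m) * t := by
          rw [ht, pow_succ]; field_simp
        rw [this] at h6
        exact le_of_mul_le_mul_right h6 htpos
      calc ((m : ℝ) / ((m + 1 : ℕ) : ℝ)) ^ m * K * P
          = ((m : ℝ) / ((m + 1 : ℕ) : ℝ)) ^ m * (K * P) := by ring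
        _ ≤ ((m : ℝ) / ((m + 1 : ℕ) : ℝ)) ^ m * (B * (((m : ℝ) + 1) / m) ^ m) := by gcongr
        _ = B * (((m : ℝ) / ((m + 1 : ℕ) : ℝ)) * (((m : ℝ) + 1) / m)) ^ m := by
          rw [mul_pow]; ring
        _ = B := by
          have : ((m : ℝ) / ((m + 1 : ℕ) : ℝ)) * (((m : ℝ) + 1) / m) = 1 := by
            push_cast; field_simp
          rw [this]; simp

end Gurvits2

section Perm
set_option linter.unusedSectionVars false
open MvPolynomial
variable {ι : Type*} [Fintype ι] [DecidableEq ι]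

lemma iterDeriv_add (m : ℕ) : ∀ (a : Fin m → ι → ℝ) (p q : MvPolynomial ι ℝ),
    iterDeriv m a (p + q) = iterDeriv m a p + iterDeriv m a q := by
  induction m with
  | zero => intro a p q; rfl
  | succ m ih => intro a p q; simp only [iterDeriv, dirDeriv_add, ih]

lemma dirDeriv_C_mul (a : ι → ℝ) (c : ℝ) (p : MvPolynomial ι ℝ) :
    dirDeriv a (C c * p) = C c * dirDeriv a p := by
  simp only [dirDeriv, pderiv_C_mul, Finset.mul_sum]
  apply Finset.sum_congr rfl
  intros; ring

lemma iterDeriv_C_mul (m : ℕ) : ∀ (a : Fin m → ι → ℝ) (c : ℝ) (p : MvPolynomial ι ℝ),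
    iterDeriv m a (C c * p) = C c * iterDeriv m a p := by
  induction m with
  | zero => intro a p q; rfl
  | succ m ih => intro a p q; simp only [iterDeriv, dirDeriv_C_mul, ih]

lemma iterDeriv_sum {κ : Type*} (m : ℕ) (a : Fin m → ι → ℝ) (s : Finset κ)
    (f : κ → MvPolynomial ι ℝ) :
    iterDeriv m a (∑ k ∈ s, f k) = ∑ k ∈ s, iterDeriv m a (f k) := by
  classical
  induction s using Finset.induction_on with
  | empty =>
    have := iterDeriv_C_mul m a 0 0
    simpa using this
  | insert k s hk ih => rw [Finset.sum_insert hk, Finset.sum_insert hk, iterDeriv_add, ih]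

lemma dirDeriv_prod_X (a : ι → ℝ) (S : Finset ι) :
    dirDeriv a (∏ i ∈ S, X i) = ∑ i ∈ S, C (a i) * ∏ k ∈ S.erase i, X k := by
  induction S using Finset.induction_on with
  | empty => simp [dirDeriv]
  | insert i S hi ih =>
    rw [Finset.prod_insert hi, dirDeriv_mul, dirDeriv_X, ih, Finset.sum_insert hi,
      Finset.erase_insert hi, Finset.mul_sum]
    congr 1
    apply Finset.sum_congr rfl
    intro k hk
    have hki : i ≠ k := by rintro rfl; exact hi hk
    rw [Finset.erase_insert_of_ne hki, Finset.prod_insert (by simp [hi])]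
    ring

open Classical in
lemma eval_iterDeriv_prod_X (m : ℕ) : ∀ (a : Fin m → ι → ℝ) (S : Finset ι) (_ : S.card = m),
    eval 0 (iterDeriv m a (∏ i ∈ S, X i)) =
      ∑ f : Fin m → ι, if (Function.Injective f ∧ ∀ j, f j ∈ S) then ∏ j, a j (f j) else 0 := by
  induction m with
  | zero =>
    intro a S hS
    rw [Finset.card_eq_zero] at hS
    subst hS
    simp [iterDeriv, Function.injective_of_subsingleton]
  | succ m ih =>
    intro a S hS
    rw [iterDeriv, dirDeriv_prod_X, iterDeriv_sum, map_sum,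
      ← (Fin.consEquiv (fun _ => ι)).sum_comp, Fintype.sum_prod_type, ← Finset.sum_subset
        (Finset.subset_univ S)]
    · apply Finset.sum_congr rfl
      intro i hi
      rw [iterDeriv_C_mul, map_mul, eval_C, ih _ _ (by rw [Finset.card_erase_of_mem hi, hS]; rfl),
        Finset.mul_sum]
      apply Finset.sum_congr rfl
      intro g _
      have hiff : (Function.Injective (Fin.consEquiv (fun _ => ι) (i, g)) ∧
          ∀ j, Fin.consEquiv (fun _ => ι) (i, g) j ∈ S) ↔
          (Function.Injective g ∧ ∀ j, g j ∈ S.erase i) := by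
        change (Function.Injective (Fin.cons i g : Fin (m + 1) → ι) ∧
          ∀ j, (Fin.cons i g : Fin (m + 1) → ι) j ∈ S) ↔ _
        rw [Fin.cons_injective_iff, Fin.forall_fin_succ]
        simp only [Fin.cons_zero, Fin.cons_succ, Finset.mem_erase, Set.mem_range, not_exists]
        constructor
        · rintro ⟨⟨h1, h2⟩, h3, h4⟩
          exact ⟨h2, fun j => ⟨h1 j, h4 j⟩⟩
        · rintro ⟨h1, h2⟩
          exact ⟨⟨fun j => (h2 j).1, h1⟩, hi, fun j => (h2 j).2⟩
      by_cases h : (Function.Injective g ∧ ∀ j, g j ∈ S.erase i)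
      · rw [if_pos h, if_pos (hiff.2 h), Fin.prod_univ_succ]
        rfl
      · rw [if_neg h, if_neg (fun h' => h (hiff.1 h')), mul_zero]
    · intro i _ hi
      apply Finset.sum_eq_zero
      intro g _
      rw [if_neg]
      rintro ⟨_, h⟩
      exact hi (by simpa [Fin.consEquiv] using h 0)

lemma permanent_eq_iterDeriv {n : ℕ} (p : Matrix (Fin n) (Fin n) ℝ) :
    permanent p = eval 0 (iterDeriv n (fun j i => p j i) (∏ i, X i)) := by
  classical
  rw [eval_iterDeriv_prod_X n _ _ (by simp), ← Finset.sum_filter, permanent]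
  refine Finset.sum_bij (fun σ _ => (σ : Fin n → Fin n)) ?_ ?_ ?_ ?_
  · intro σ _
    simp [σ.injective]
  · intro σ _ τ _ h
    exact Equiv.ext (congrFun h)
  · intro f hf
    simp only [Finset.mem_filter, Finset.mem_univ, true_and, implies_true, and_true] at hf
    exact ⟨Equiv.ofBijective f (Finite.injective_iff_bijective.1 hf), Finset.mem_univ _, rfl⟩
  · intro σ _
    rfl

lemma goodPoly_prod_X (n : ℕ) : GoodPoly n (∏ i : Fin n, X i : MvPolynomial (Fin n) ℝ) where
  hom := by
    have := IsHomogeneous.prod Finset.univ (fun i : Fin n => (X i : MvPolynomial (Fin n) ℝ))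
      (fun _ => 1) (fun i _ => isHomogeneous_X ℝ i)
    simpa using this
  stable := by
    intro z hz
    rw [map_prod]
    apply Finset.prod_ne_zero_iff.2
    intro i _ h
    rw [aeval_X] at h
    have := hz i
    rw [h] at this
    simp at this
  pos := by
    intro y hy
    rw [map_prod]
    apply Finset.prod_pos
    intro i _
    simpa using hy i

theorem permanent_ge_of_pos {n : ℕ} (p : Matrix (Fin n) (Fin n) ℝ) (hp : ∀ i j, 0 < p i j) (K : ℝ)
    (hK : ∀ x : Fin n → ℝ, (∀ j, 0 < x j) → K * ∏ j, x j ≤ ∏ i, ∑ j, x j * p j i) :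
    ((n.factorial : ℝ) / (n : ℝ) ^ n) * K ≤ permanent p := by
  rw [permanent_eq_iterDeriv]
  apply gurvits n _ _ (fun j i => hp j i) (goodPoly_prod_X n)
  intro x hx
  rw [map_prod]
  simpa using hK x hx

theorem permanent_ge {n : ℕ} (p : Matrix (Fin n) (Fin n) ℝ) (hp : ∀ i j, 0 ≤ p i j) (K : ℝ)
    (hK : ∀ x : Fin n → ℝ, (∀ j, 0 < x j) → K * ∏ j, x j ≤ ∏ i, ∑ j, x j * p j i) :
    ((n.factorial : ℝ) / (n : ℝ) ^ n) * K ≤ permanent p := by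
  have hcont : Continuous (fun ε : ℝ => permanent (fun i j => p i j + ε)) := by
    unfold permanent
    fun_prop
  have hlim : Filter.Tendsto (fun ε : ℝ => permanent (fun i j => p i j + ε))
      (nhdsWithin 0 (Set.Ioi 0)) (nhds (permanent p)) := by
    have := (hcont.tendsto 0).mono_left (nhdsWithin_le_nhds (s := Set.Ioi 0))
    simpa using this
  refine ge_of_tendsto hlim ?_
  filter_upwards [self_mem_nhdsWithin] with ε hε
  have hε' : (0 : ℝ) < ε := hε
  apply permanent_ge_of_pos _ (fun i j => add_pos_of_nonneg_of_pos (hp i j) hε')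
  intro x hx
  refine (hK x hx).trans ?_
  apply Finset.prod_le_prod
  · intro i _
    exact Finset.sum_nonneg (fun j _ => mul_nonneg (hx j).le (hp j i))
  · intro i _
    apply Finset.sum_le_sum
    intro j _
    have := hx j
    apply mul_le_mul_of_nonneg_left _ this.le
    linarith

end Perm

theorem fractional_vdW_bound {n : ℕ} (β : Matrix (Fin n) (Fin n) ℝ)
    (hβ : DoublyStochastic β) (hlt : ∀ i j, β i j < 1)
    (γ : ℝ) (hγ : γ ∈ Set.Icc (-1 : ℝ) 1) :
    ((n.factorial : ℝ) / (n : ℝ) ^ n) *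
      ∏ i, ∏ j, (1 - β i j) ^ (-(γ * β i j)) ≤
    permanent (fun i j => β i j * (1 - β i j) ^ (-γ)) := by
  obtain ⟨h0, hrow, hcol⟩ := hβ
  have h1 : ∀ i j, 0 < 1 - β i j := fun i j => sub_pos.2 (hlt i j)
  apply permanent_ge
  · intro i j
    exact mul_nonneg (h0 i j) (Real.rpow_nonneg (h1 i j).le _)
  · intro x hx
    have hx' : ∏ j, x j = ∏ i, ∏ j, x j ^ β j i := by
      rw [Finset.prod_comm]
      apply Finset.prod_congr rfl
      intro j _
      rw [← Real.rpow_sum_of_pos (hx j), hrow j, Real.rpow_one]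
    rw [hx', Finset.prod_comm, ← Finset.prod_mul_distrib]
    apply Finset.prod_le_prod
    · intro i _
      apply mul_nonneg
      · exact Finset.prod_nonneg (fun j _ => Real.rpow_nonneg (h1 j i).le _)
      · exact Finset.prod_nonneg (fun j _ => Real.rpow_nonneg (hx j).le _)
    · intro i _
      have key := Real.geom_mean_le_arith_mean_weighted Finset.univ (fun j => β j i)
        (fun j => x j * (1 - β j i) ^ (-γ)) (fun j _ => h0 j i) (hcol i)
        (fun j _ => mul_nonneg (hx j).le (Real.rpow_nonneg (h1 j i).le _))
      calc _ = ∏ j, (x j * (1 - β j i) ^ (-γ)) ^ β j i := by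
            rw [← Finset.prod_mul_distrib]
            apply Finset.prod_congr rfl
            intro j _
            rw [Real.mul_rpow (hx j).le (Real.rpow_nonneg (h1 j i).le _),
              ← Real.rpow_mul (h1 j i).le, neg_mul, mul_comm]
        _ ≤ _ := key
        _ = _ := by
            apply Finset.sum_congr rfl
            intro j _
            ring
end

section
/- Let p be an n×n real matrix with nonnegative entries and let γ ∈ [−1,1]. Suppose β lies in the interior of the β-polytope 𝓑_p of p and solves the γ-fractional equations for p. Then perm(p) ≥ Z_f^γ(β|p) · (n!/n^n) · ∏_{(i,j): p_ij>0} (1−β_ij)^{γ·(1−β_ij)}. -/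
open scoped BigOperators

lemma aux_tangent (s y : ℝ) (hs : 0 < s) :
    1 + y ≤ (1 + s) * Real.exp ((y - s) / (1 + s)) := by
  have h := Real.add_one_le_exp ((y - s) / (1 + s))
  have h1 : 1 + y = (1 + s) * ((y - s) / (1 + s) + 1) := by field_simp; ring
  rw [h1]
  gcongr

lemma aux_prod (s : ℝ) (hs : 0 < s) (t : ℝ) (ht : 0 < t) (b : Multiset ℝ) (hb : ∀ x ∈ b, 0 ≤ x) :
    (b.map (fun x => 1 + x * t)).prod ≤
      (1 + s) ^ (Multiset.card b) * Real.exp ((b.sum * t - Multiset.card b * s) / (1 + s)) := by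
  induction b using Multiset.induction_on with
  | empty => simp
  | cons a b ih =>
    have ha : 0 ≤ a := hb a (by simp)
    have ih' := ih (fun x hx => hb x (by simp [hx]))
    have h0 : 0 ≤ (b.map (fun x => 1 + x * t)).prod := by
      apply Multiset.prod_nonneg
      intro y hy
      obtain ⟨x, hx, rfl⟩ := Multiset.mem_map.1 hy
      have := hb x (by simp [hx])
      positivity
    have h1 := aux_tangent s (a * t) hs
    simp only [Multiset.map_cons, Multiset.prod_cons, Multiset.card_cons, Multiset.sum_cons]
    calc _ ≤ ((1 + s) * Real.exp ((a * t - s) / (1 + s))) * ((1 + s) ^ (Multiset.card b) *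
          Real.exp ((b.sum * t - Multiset.card b * s) / (1 + s))) := by gcongr
      _ = (1 + s) ^ (Multiset.card b + 1) * (Real.exp ((a * t - s) / (1 + s)) *
          Real.exp ((b.sum * t - Multiset.card b * s) / (1 + s))) := by ring
      _ = _ := by
        rw [← Real.exp_add]; congr 2; push_cast; ring

lemma aux_prod2 (m : ℕ) (hm : 0 < m) (b : Multiset ℝ) (hb : ∀ x ∈ b, 0 ≤ x)
    (hc : Multiset.card b ≤ m) (s t : ℝ) (hs : 0 < s) (ht : 0 < t) (hst : b.sum * t = m * s) :
    (b.map (fun x => 1 + x * t)).prod ≤ (1 + s) ^ m := by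
  refine (aux_prod s hs t ht b hb).trans ?_
  obtain ⟨e, rfl⟩ := Nat.exists_eq_add_of_le hc
  have h1 : Real.exp (s / (1 + s)) ≤ 1 + s := by
    have h := aux_tangent s 0 hs
    have h2 : (0 - s) / (1 + s) = -(s / (1 + s)) := by ring
    rw [h2, Real.exp_neg, ← div_eq_mul_inv, le_div_iff₀ (Real.exp_pos _)] at h
    linarith
  have h2 : Real.exp ((b.sum * t - Multiset.card b * s) / (1 + s)) = Real.exp (s / (1 + s)) ^ e := by
    rw [← Real.exp_nat_mul, hst]; congr 1; push_cast; ring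
  rw [h2, pow_add]
  gcongr

lemma aux_univ (k : ℕ) (R : Polynomial ℂ) (hd : R.natDegree ≤ k + 1) (C : ℝ) (hC : 0 < C)
    (hR : ∀ t : ℝ, 0 < t → C * t ≤ (R.eval (t : ℂ)).re)
    (hroots : k ≠ 0 → ∀ z : ℂ, R.eval z = 0 → z.im = 0 ∧ z.re < 0) :
    C * ((k : ℝ) / (k + 1)) ^ k ≤ (R.coeff 1).re := by
  rcases Nat.eq_zero_or_pos k with rfl | hk
  · simp only [pow_zero, mul_one]
    have hE : ∀ t : ℝ, (R.eval (t : ℂ)).re = (R.coeff 0).re + (R.coeff 1).re * t := by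
      intro t
      rw [Polynomial.eval_eq_sum_range' (n := 2) (by omega)]
      simp [Finset.sum_range_succ]
    by_contra! h
    set c := (R.coeff 1).re
    set r := (R.coeff 0).re
    have hpos : 0 < C - c := by linarith
    have h1 := hR ((|r| + 1) / (C - c)) (by positivity)
    rw [hE] at h1
    have h2 : (C - c) * ((|r| + 1) / (C - c)) = |r| + 1 := by field_simp
    have := le_abs_self r
    nlinarith
  · have hroots := hroots hk.ne'
    have hR0 : R.eval 0 ≠ 0 := fun h => by simpa using (hroots 0 h).2
    have hRne : R ≠ 0 := by rintro rfl; simp at hR0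
    have hspl : R.Splits := IsAlgClosed.splits R
    set b : Multiset ℝ := R.roots.map (fun z => -(z.re)⁻¹) with hbdef
    have hbpos : ∀ x ∈ b, 0 < x := by
      intro x hx
      obtain ⟨z, hz, rfl⟩ := Multiset.mem_map.1 hx
      have := (hroots z ((Polynomial.mem_roots hRne).1 hz)).2
      have := inv_lt_zero.2 this
      linarith
    have hcard : Multiset.card b ≤ k + 1 := by
      rw [hbdef, Multiset.card_map]; exact (Polynomial.card_roots' R).trans hd
    have hev : ∀ t : ℝ, R.eval (t : ℂ) = R.eval 0 * ((b.map (fun x => 1 + x * t)).prod : ℝ) := by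
      intro t
      rw [hspl.eval_eq_prod_roots, hspl.eval_eq_prod_roots, mul_assoc]
      congr 1
      rw [hbdef, Multiset.map_map, show ∀ y : ℝ, (y : ℂ) = Complex.ofRealHom y from fun _ => rfl,
        show ∀ y : ℝ, (y : ℂ) = Complex.ofRealHom y from fun _ => rfl,
        map_multiset_prod, Multiset.map_map, ← Multiset.prod_map_mul]
      congr 1
      apply Multiset.map_congr rfl
      intro z hz
      obtain ⟨h1, h2⟩ := hroots z ((Polynomial.mem_roots hRne).1 hz)
      have h3 : z = (z.re : ℂ) := by apply Complex.ext <;> simp [h1]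
      have h4 : (z.re : ℂ) ≠ 0 := by exact_mod_cast h2.ne
      simp only [Function.comp, Complex.ofRealHom_eq_coe]
      push_cast
      rw [h3]; simp only [Complex.ofReal_re]; field_simp; ring
    have hc1 : R.coeff 1 = R.eval 0 * (b.sum : ℝ) := by
      have h1 : R.coeff 1 = R.derivative.eval 0 := by
        rw [← Polynomial.coeff_zero_eq_eval_zero, Polynomial.coeff_derivative]; simp
      have h2 := hspl.eval_derivative_div_eval_of_ne_zero hR0
      rw [h1, ← mul_div_cancel₀ (R.derivative.eval 0) hR0, h2]
      congr 1
      rw [hbdef, show ∀ y : ℝ, (y : ℂ) = Complex.ofRealHom y from fun _ => rfl, map_multiset_sum, Multiset.map_map]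
      congr 1
      apply Multiset.map_congr rfl
      intro z hz
      obtain ⟨h1, h2⟩ := hroots z ((Polynomial.mem_roots hRne).1 hz)
      have h3 : z = (z.re : ℂ) := by apply Complex.ext <;> simp [h1]
      simp only [Function.comp, Complex.ofRealHom_eq_coe]
      push_cast
      rw [h3]; simp [inv_neg]
    have hre : ∀ t : ℝ, (R.eval (t : ℂ)).re = (R.eval 0).re * (b.map (fun x => 1 + x * t)).prod := by
      intro t; rw [hev, Complex.re_mul_ofReal]
    set u := (R.eval 0).re
    rw [hc1, Complex.re_mul_ofReal]
    have hB0 : 0 ≤ b.sum := Multiset.sum_nonneg (fun x hx => (hbpos x hx).le)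
    have hBpos : 0 < b.sum := by
      rcases hB0.lt_or_eq with h | h
      · exact h
      exfalso
      have hb0 : b = 0 := by
        by_contra hne
        obtain ⟨a, ha⟩ := Multiset.exists_mem_of_ne_zero hne
        have := Multiset.single_le_sum (fun x hx => (hbpos x hx).le) a ha
        have := hbpos a ha
        linarith
      have h1 := hR ((|u| + 1) / C) (by positivity)
      rw [hre, hb0] at h1
      have h2 : C * ((|u| + 1) / C) = |u| + 1 := by field_simp
      have := le_abs_self u
      simp at h1
      linarith
    have hk' : (0 : ℝ) < k := by exact_mod_cast hk
    have h1 := hR (((k : ℝ) + 1) / (k * b.sum)) (by positivity)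
    have h2 := aux_prod2 (k + 1) (by omega) b (fun x hx => (hbpos x hx).le) hcard (1 / k)
      (((k : ℝ) + 1) / (k * b.sum)) (by positivity) (by positivity) (by push_cast; field_simp)
    have h0 : 0 < (b.map (fun x => 1 + x * (((k : ℝ) + 1) / (k * b.sum)))).prod := by
      apply Multiset.prod_pos
      intro y hy
      obtain ⟨x, hx, rfl⟩ := Multiset.mem_map.1 hy
      have := hbpos x hx
      positivity
    rw [hre] at h1
    have hu : 0 < u := by
      have : 0 < u * (b.map (fun x => 1 + x * (((k : ℝ) + 1) / (k * b.sum)))).prod := 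
        lt_of_lt_of_le (by positivity) h1
      exact pos_of_mul_pos_left this h0.le
    have h3 : C * (((k : ℝ) + 1) / (k * b.sum)) ≤ u * (1 + 1 / k) ^ (k + 1) :=
      h1.trans (by gcongr)
    have h4 : (1 + 1 / (k : ℝ)) = (k + 1) / k := by field_simp
    rw [h4, pow_succ] at h3
    have h5 : ((k : ℝ) / (k + 1)) ^ k * (((k : ℝ) + 1) / k) ^ k = 1 := by
      rw [← mul_pow, div_mul_div_comm, mul_comm, div_self (by positivity), one_pow]
    have h6 : C ≤ u * b.sum * (((k : ℝ) + 1) / k) ^ k := by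
      have h7 : 0 < ((k : ℝ) + 1) / (k * b.sum) := by positivity
      refine le_of_mul_le_mul_right (h3.trans (le_of_eq ?_)) h7
      field_simp
    calc C * ((k : ℝ) / (k + 1)) ^ k ≤ (u * b.sum * (((k : ℝ) + 1) / k) ^ k) * ((k : ℝ) / (k + 1)) ^ k := by gcongr
      _ = u * b.sum * (((k : ℝ) / (k + 1)) ^ k * (((k : ℝ) + 1) / k) ^ k) := by ring
      _ = _ := by rw [h5, mul_one]

lemma aux_hom {k m : ℕ} (P : MvPolynomial (Fin k) ℂ) (hP : P.IsHomogeneous m) (l : ℂ)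
    (z : Fin k → ℂ) :
    MvPolynomial.eval (fun i => l * z i) P = l ^ m * MvPolynomial.eval z P := by
  rw [MvPolynomial.eval_eq', MvPolynomial.eval_eq', Finset.mul_sum]
  refine Finset.sum_congr rfl fun d hd => ?_
  have h := hP.degree_eq_sum_deg_support hd
  have h2 : ∑ i, d i = m := by
    rw [h]
    symm
    exact Finset.sum_subset (Finset.subset_univ _) (by simp)
  simp only [mul_pow, Finset.prod_mul_distrib, Finset.prod_pow_eq_pow_sum, h2]
  ring

/-- Strict half-plane stability. -/
def HStab {k : ℕ} (P : MvPolynomial (Fin k) ℂ) : Prop :=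
  ∀ z : Fin k → ℂ, (∀ i, 0 ≤ (z i).re) → (∃ i, 0 < (z i).re) → MvPolynomial.eval z P ≠ 0

lemma aux_rot (t : ℂ) (h : ¬ (t.im = 0 ∧ t.re < 0)) : ∃ l : ℂ, 0 < l.re ∧ 0 ≤ (l * t).re := by
  by_cases h0 : 0 ≤ t.re
  · exact ⟨1, by simp, by simpa⟩
  have him : t.im ≠ 0 := fun h1 => h ⟨h1, not_le.1 h0⟩
  rcases lt_or_gt_of_ne him with h1 | h1
  · refine ⟨⟨-t.im, -t.re⟩, by simpa, ?_⟩
    simp [Complex.mul_re]; linarith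
  · refine ⟨⟨t.im, t.re⟩, by simpa, ?_⟩
    simp [Complex.mul_re]; linarith

lemma aux_top {k : ℕ} (P : MvPolynomial (Fin (k + 1)) ℂ) (hP : P.IsHomogeneous (k + 1))
    (hS : HStab P) (z : Fin k → ℂ) :
    MvPolynomial.eval z ((MvPolynomial.finSuccEquiv ℂ k P).coeff (k + 1)) ≠ 0 := by
  have hdeg : (MvPolynomial.finSuccEquiv ℂ k P).natDegree ≤ k + 1 := by
    rw [MvPolynomial.natDegree_finSuccEquiv]
    exact (MvPolynomial.degreeOf_le_totalDegree _ _).trans hP.totalDegree_le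
  have h0 := hP.finSuccEquiv_coeff_isHomogeneous (k + 1) 0 (by omega)
  have h1 : ∀ w, MvPolynomial.eval w ((MvPolynomial.finSuccEquiv ℂ k P).coeff (k + 1)) =
      MvPolynomial.eval 0 ((MvPolynomial.finSuccEquiv ℂ k P).coeff (k + 1)) := by
    intro w
    have := aux_hom _ h0 0 w
    simp only [zero_mul, pow_zero, one_mul] at this
    exact this.symm
  rw [h1]
  have h2 := hS (Fin.cons 1 0) (by
    intro i; refine Fin.cases ?_ (fun j => ?_) i <;> simp) ⟨0, by simp⟩
  rw [MvPolynomial.eval_eq_eval_mv_eval', Polynomial.eval_eq_sum_range' (n := k + 2)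
    (lt_of_le_of_lt Polynomial.natDegree_map_le (by omega)), Finset.sum_range_succ,
    Finset.sum_eq_zero] at h2
  · simpa using h2
  · intro i hi
    have hi' : i < k + 1 := Finset.mem_range.1 hi
    have h3 := hP.finSuccEquiv_coeff_isHomogeneous i (k + 1 - i) (by omega)
    have h4 := aux_hom _ h3 0 0
    rw [zero_pow (by omega), zero_mul] at h4
    simp only [Pi.zero_apply, mul_zero] at h4
    rw [Polynomial.coeff_map]
    have h5 : (MvPolynomial.eval (0 : Fin k → ℂ)) ((MvPolynomial.finSuccEquiv ℂ k P).coeff i) = 0 := h4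
    rw [h5, zero_mul]

lemma aux_stab {k : ℕ} (P : MvPolynomial (Fin (k + 1)) ℂ) (hP : P.IsHomogeneous (k + 1))
    (hS : HStab P) : HStab ((MvPolynomial.finSuccEquiv ℂ k P).coeff 1) := by
  intro z hz0 hz1 hzero
  set R := Polynomial.map (MvPolynomial.eval z) (MvPolynomial.finSuccEquiv ℂ k P) with hR
  have htop : R.coeff (k + 1) ≠ 0 := by
    rw [hR, Polynomial.coeff_map]; exact aux_top P hP hS z
  have hdeg : 0 < R.degree := by
    rw [← Polynomial.natDegree_pos_iff_degree_pos]
    have := Polynomial.le_natDegree_of_ne_zero htop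
    omega
  have hRne : R ≠ 0 := by rintro h; simp [h] at htop
  have hroot : ∀ t : ℂ, R.eval t = 0 → t.re < 0 := by
    intro t ht
    by_contra! hc
    refine hS (Fin.cons t z) ?_ ?_ ?_
    · intro i; refine Fin.cases ?_ (fun j => ?_) i
      · simpa
      · simpa using hz0 j
    · obtain ⟨i, hi⟩ := hz1
      exact ⟨i.succ, by simpa⟩
    · rw [MvPolynomial.eval_eq_eval_mv_eval']; exact ht
  have hc1 : R.derivative.eval 0 = 0 := by
    rw [← Polynomial.coeff_zero_eq_eval_zero, Polynomial.coeff_derivative, hR, Polynomial.coeff_map]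
    simp [hzero]
  have hspl : R.Splits := IsAlgClosed.splits R
  have hR0 : R.eval 0 ≠ 0 := fun h => by simpa using hroot 0 h
  have hsum := hspl.eval_derivative_div_eval_of_ne_zero hR0
  rw [hc1, zero_div] at hsum
  have hpos : 0 < (R.roots.map fun z ↦ 1 / (0 - z)).sum.re := by
    rw [show ∀ y : ℂ, y.re = Complex.reLm y from fun _ => rfl, map_multiset_sum, Multiset.map_map]
    have hne : R.roots ≠ 0 := hspl.roots_ne_zero (by
      have := Polynomial.natDegree_pos_iff_degree_pos.2 hdeg; omega)
    obtain ⟨a, ha⟩ := Multiset.exists_mem_of_ne_zero hne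
    have hterm : ∀ w ∈ R.roots, 0 < (1 / (0 - w)).re := by
      intro w hw
      have hw' := hroot w ((Polynomial.mem_roots hRne).1 hw)
      have : w ≠ 0 := by rintro rfl; simp at hw'
      simp only [zero_sub, one_div, Complex.inv_re, Complex.neg_re, Complex.normSq_neg]
      have := Complex.normSq_pos.2 this
      apply div_pos <;> linarith
    refine lt_of_lt_of_le (hterm a ha) (Multiset.single_le_sum ?_ _ ?_)
    · intro x hx
      obtain ⟨w, hw, rfl⟩ := Multiset.mem_map.1 hx
      exact (hterm w hw).le
    · exact Multiset.mem_map.2 ⟨a, ha, rfl⟩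
  rw [← hsum] at hpos
  simp at hpos

lemma aux_gurvits (k : ℕ) : ∀ (P : MvPolynomial (Fin k) ℂ) (C : ℝ), P.IsHomogeneous k →
    HStab P → 0 < C →
    (∀ x : Fin k → ℝ, (∀ i, 0 < x i) →
      C * ∏ i, x i ≤ (MvPolynomial.eval (fun i => (x i : ℂ)) P).re) →
    C * ((k.factorial : ℝ) / (k : ℝ) ^ k) ≤
      (MvPolynomial.coeff (Finsupp.equivFunOnFinite.symm (fun _ => 1)) P).re := by
  induction k with
  | zero =>
    intro P C hP hS hC hx
    have h := hx (fun _ => 1) (by simp)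
    have h2 : MvPolynomial.eval (fun i : Fin 0 => (((fun _ => 1 : Fin 0 → ℝ) i : ℝ) : ℂ)) P =
      MvPolynomial.coeff (Finsupp.equivFunOnFinite.symm (fun _ => 1)) P := by
      obtain ⟨c, rfl⟩ := MvPolynomial.C_surjective (Fin 0) P
      rw [MvPolynomial.eval_C, Subsingleton.elim (Finsupp.equivFunOnFinite.symm (fun _ => 1) : Fin 0 →₀ ℕ) 0]
      simp
    rw [h2] at h
    simpa using h
  | succ k ih =>
    intro P C hP hS hC hx
    have hdeg : (MvPolynomial.finSuccEquiv ℂ k P).natDegree ≤ k + 1 := by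
      rw [MvPolynomial.natDegree_finSuccEquiv]
      exact (MvPolynomial.degreeOf_le_totalDegree _ _).trans hP.totalDegree_le
    have hg : 0 < ((k : ℝ) / (k + 1)) ^ k := by
      rcases Nat.eq_zero_or_pos k with rfl | h
      · simp
      · positivity
    have key := ih ((MvPolynomial.finSuccEquiv ℂ k P).coeff 1) (C * ((k : ℝ) / (k + 1)) ^ k)
      (hP.finSuccEquiv_coeff_isHomogeneous 1 k (by omega)) (aux_stab P hP hS) (by positivity) (by
        intro x hxpos
        have hprod : 0 < ∏ i, x i := Finset.prod_pos (fun i _ => hxpos i)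
        have := aux_univ k (Polynomial.map (MvPolynomial.eval (fun i => (x i : ℂ)))
          (MvPolynomial.finSuccEquiv ℂ k P)) (Polynomial.natDegree_map_le.trans hdeg)
          (C * ∏ i, x i) (by positivity) (by
            intro t ht
            have h := hx (Fin.cons t x) (by
              intro i; refine Fin.cases ?_ (fun j => ?_) i
              · simpa
              · simpa using hxpos j)
            have h2 : (fun i => ((Fin.cons t x : Fin (k + 1) → ℝ) i : ℂ)) =
                Fin.cons (t : ℂ) (fun i => (x i : ℂ)) := by
              funext i; refine Fin.cases ?_ (fun j => ?_) i <;> simp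
            rw [h2, MvPolynomial.eval_eq_eval_mv_eval', Fin.prod_univ_succ] at h
            simp only [Fin.cons_zero, Fin.cons_succ] at h
            linarith) (by
            intro hk t ht
            by_contra hc
            obtain ⟨l, hl1, hl2⟩ := aux_rot t hc
            rw [← MvPolynomial.eval_eq_eval_mv_eval'] at ht
            refine hS (fun i => l * (Fin.cons t (fun i => (x i : ℂ)) : Fin (k + 1) → ℂ) i) ?_ ?_ ?_
            · intro i; refine Fin.cases ?_ (fun j => ?_) i
              · simpa using hl2
              · simpa using mul_nonneg hl1.le (hxpos j).le
            · refine ⟨Fin.succ ⟨0, Nat.pos_of_ne_zero hk⟩, ?_⟩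
              rw [Fin.cons_succ, Complex.re_mul_ofReal]
              exact mul_pos hl1 (hxpos _)
            · rw [aux_hom _ hP, ht, mul_zero])
        rw [Polynomial.coeff_map] at this
        linarith)
    rw [MvPolynomial.finSuccEquiv_coeff_coeff] at key
    have hcons : Finsupp.cons 1 (Finsupp.equivFunOnFinite.symm (fun _ => 1) : Fin k →₀ ℕ) =
        Finsupp.equivFunOnFinite.symm (fun _ => 1) := by
      ext i; refine Fin.cases ?_ (fun j => ?_) i <;> simp
    rw [hcons] at key
    refine le_trans (le_of_eq ?_) key
    rw [Nat.factorial_succ, pow_succ, div_pow, mul_assoc]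
    congr 1
    push_cast
    have : (k : ℝ) ^ k ≠ 0 := by
      rcases Nat.eq_zero_or_pos k with rfl | h
      · simp
      · positivity
    field_simp

lemma aux_coeff {n : ℕ} (A : Matrix (Fin n) (Fin n) ℝ) :
    MvPolynomial.coeff (Finsupp.equivFunOnFinite.symm (fun _ => 1))
      (∏ i, ∑ j, MvPolynomial.C (A i j : ℂ) * MvPolynomial.X j) =
    ((∑ σ : Equiv.Perm (Fin n), ∏ i, A i (σ i) : ℝ) : ℂ) := by
  classical
  rw [Finset.prod_univ_sum, MvPolynomial.coeff_sum, Fintype.piFinset_univ]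
  have hterm : ∀ f : Fin n → Fin n, MvPolynomial.coeff (Finsupp.equivFunOnFinite.symm (fun _ => 1))
      (∏ i, MvPolynomial.C (A i (f i) : ℂ) * MvPolynomial.X (f i)) =
      if Function.Bijective f then ∏ i, (A i (f i) : ℂ) else 0 := by
    intro f
    rw [Finset.prod_mul_distrib, ← map_prod, MvPolynomial.coeff_C_mul]
    have hX : (∏ i, (MvPolynomial.X (f i) : MvPolynomial (Fin n) ℂ)) =
        MvPolynomial.monomial (∑ i, Finsupp.single (f i) 1) 1 := by
      rw [MvPolynomial.monomial_sum_one]; rfl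
    rw [hX, MvPolynomial.coeff_monomial]
    have hiff : (∑ i, Finsupp.single (f i) 1 = (Finsupp.equivFunOnFinite.symm (fun _ => 1) : Fin n →₀ ℕ))
        ↔ Function.Bijective f := by
      constructor
      · intro h
        rw [← Finite.surjective_iff_bijective]
        intro j
        by_contra! hj
        have := DFunLike.congr_fun h j
        simp [Finsupp.finsetSum_apply, Finsupp.single_apply, hj] at this
      · intro h
        ext j
        rw [Finsupp.finsetSum_apply]
        have := Function.Bijective.sum_comp h (fun i => (Finsupp.single i 1 : Fin n →₀ ℕ) j)
        rw [this]
        simp [Finsupp.single_apply]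
    simp only [hiff]
    split_ifs <;> simp
  rw [Finset.sum_congr rfl (fun f _ => hterm f), ← Finset.sum_filter]
  push_cast
  symm
  refine Finset.sum_bij (fun σ _ => (σ : Fin n → Fin n)) ?_ ?_ ?_ ?_
  · intro σ _; exact Finset.mem_filter.2 ⟨Finset.mem_univ _, σ.bijective⟩
  · intro σ _ τ _ h; exact DFunLike.coe_injective h
  · intro f hf
    exact ⟨Equiv.ofBijective f (Finset.mem_filter.1 hf).2, Finset.mem_univ _, rfl⟩
  · intro σ _; rfl

lemma aux_perm_pos {n : ℕ} (A : Matrix (Fin n) (Fin n) ℝ) (hA : ∀ i j, 0 < A i j) (C : ℝ)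
    (hC : 0 < C) (h : ∀ x : Fin n → ℝ, (∀ i, 0 < x i) → C * ∏ i, x i ≤ ∏ i, ∑ j, A i j * x j) :
    C * ((n.factorial : ℝ) / (n : ℝ) ^ n) ≤ ∑ σ : Equiv.Perm (Fin n), ∏ i, A i (σ i) := by
  have := aux_gurvits n (∏ i, ∑ j, MvPolynomial.C (A i j : ℂ) * MvPolynomial.X j) C
    (by
      have := MvPolynomial.IsHomogeneous.prod Finset.univ
        (fun i => ∑ j, MvPolynomial.C (A i j : ℂ) * MvPolynomial.X j) (fun _ => 1)
        (fun i _ => MvPolynomial.IsHomogeneous.sum _ _ _ (fun j _ => MvPolynomial.isHomogeneous_C_mul_X _ _))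
      simpa using this)
    (by
      intro z hz0 hz1
      simp only [map_prod, map_sum, map_mul, MvPolynomial.eval_C, MvPolynomial.eval_X]
      rw [Finset.prod_ne_zero_iff]
      intro i _ hzero
      have h2 : 0 < (∑ j, (A i j : ℂ) * z j).re := by
        rw [Complex.re_sum]
        simp only [Complex.re_ofReal_mul]
        obtain ⟨j, hj⟩ := hz1
        exact Finset.sum_pos' (fun j _ => mul_nonneg (hA i j).le (hz0 j))
          ⟨j, Finset.mem_univ _, mul_pos (hA i j) hj⟩
      rw [hzero] at h2
      simp at h2)
    hC
    (by
      intro x hx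
      have h2 := h x hx
      simp only [map_prod, map_sum, map_mul, MvPolynomial.eval_C, MvPolynomial.eval_X]
      exact_mod_cast h2)
  rw [aux_coeff, Complex.ofReal_re] at this
  exact this

lemma aux_perm {n : ℕ} (A : Matrix (Fin n) (Fin n) ℝ) (hA : ∀ i j, 0 ≤ A i j) (C : ℝ)
    (hC : 0 < C) (h : ∀ x : Fin n → ℝ, (∀ i, 0 < x i) → C * ∏ i, x i ≤ ∏ i, ∑ j, A i j * x j) :
    C * ((n.factorial : ℝ) / (n : ℝ) ^ n) ≤ ∑ σ : Equiv.Perm (Fin n), ∏ i, A i (σ i) := by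
  have hcont : Continuous (fun e : ℝ => ∑ σ : Equiv.Perm (Fin n), ∏ i, (A i (σ i) + e)) := by
    fun_prop
  have ht := (hcont.tendsto 0).mono_left (nhdsWithin_le_nhds (s := Set.Ioi 0))
  simp only [add_zero] at ht
  refine ge_of_tendsto ht ?_
  filter_upwards [self_mem_nhdsWithin] with e he
  have he : 0 < e := he
  refine aux_perm_pos (fun i j => A i j + e) (fun i j => add_pos_of_nonneg_of_pos (hA i j) he) C hC ?_
  intro x hx
  refine (h x hx).trans (Finset.prod_le_prod ?_ ?_)
  · intro i _; exact Finset.sum_nonneg (fun j _ => mul_nonneg (hA i j) (hx j).le)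
  · intro i _
    refine Finset.sum_le_sum (fun j _ => ?_)
    have := hx j
    gcongr
    linarith

open scoped BigOperators

theorem fractional_lower_bound {n : ℕ} (γ : ℝ)
    (hγ : γ ∈ Set.Icc (-1 : ℝ) 1)
    (p β : Matrix (Fin n) (Fin n) ℝ)
    (hp : ∀ i j, 0 ≤ p i j) (hβ : InInterior p β)
    (hFrac : ∃ w w' : Fin n → ℝ, (∀ i, 0 < w i) ∧ (∀ j, 0 < w' j) ∧
      ∀ i j, β i j / (1 - β i j) ^ γ = p i j / (w i * w' j)) :
    Real.exp (-(Ff γ p β)) * ((n.factorial : ℝ) / (n : ℝ) ^ n) *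
      ∏ i, ∏ j, (if 0 < p i j then (1 - β i j) ^ (γ * (1 - β i j)) else 1) ≤
    permanent p := by
  obtain ⟨⟨⟨hb0, hrow, hcol⟩, hpz⟩, hint⟩ := hβ
  have hlt : ∀ i j, 0 < 1 - β i j := by
    intro i j
    rcases (hp i j).lt_or_eq with h | h
    · linarith [(hint i j h).2]
    · rw [hpz i j h.symm]; norm_num
  set E : ℝ := ∑ i, ∑ j, β i j * Real.log (β i j / p i j) with hE
  have hL : Real.exp (-(Ff γ p β)) *
      ∏ i, ∏ j, (if 0 < p i j then (1 - β i j) ^ (γ * (1 - β i j)) else 1) = Real.exp (-E) := by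
    have h1 : ∏ i, ∏ j, (if 0 < p i j then (1 - β i j) ^ (γ * (1 - β i j)) else 1) =
        Real.exp (∑ i, ∑ j, γ * ((1 - β i j) * Real.log (1 - β i j))) := by
      rw [Real.exp_sum]
      refine Finset.prod_congr rfl fun i _ => ?_
      rw [Real.exp_sum]
      refine Finset.prod_congr rfl fun j _ => ?_
      split_ifs with h
      · rw [Real.rpow_def_of_pos (hlt i j)]; congr 1; ring
      · rw [hpz i j (le_antisymm (not_lt.1 h) (hp i j))]; simp
    have h2 : Ff γ p β = E + ∑ i, ∑ j, γ * ((1 - β i j) * Real.log (1 - β i j)) := by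
      rw [hE, Ff, ← Finset.sum_add_distrib]
      refine Finset.sum_congr rfl fun i _ => ?_
      rw [← Finset.sum_add_distrib]
      refine Finset.sum_congr rfl fun j _ => ?_
      split_ifs with h
      · rfl
      · rw [hpz i j (le_antisymm (not_lt.1 h) (hp i j))]; simp
    rw [h1, h2, ← Real.exp_add]; congr 1; ring
  rw [mul_right_comm, hL]
  refine aux_perm p hp _ (Real.exp_pos _) ?_
  intro x hx
  have hx1 : ∏ j, x j = ∏ i, ∏ j, x j ^ β i j := by
    rw [Finset.prod_comm]
    refine Finset.prod_congr rfl fun j _ => ?_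
    rw [← Real.rpow_sum_of_pos (hx j), hcol, Real.rpow_one]
  rw [hx1, hE, ← Finset.sum_neg_distrib, Real.exp_sum, ← Finset.prod_mul_distrib]
  refine Finset.prod_le_prod (fun i _ => mul_nonneg (Real.exp_pos _).le
    (Finset.prod_nonneg fun j _ => Real.rpow_nonneg (hx j).le _)) (fun i _ => ?_)
  have ham := Real.geom_mean_le_arith_mean_weighted Finset.univ (β i)
    (fun j => p i j * x j / β i j) (fun j _ => hb0 i j) (hrow i)
    (fun j _ => div_nonneg (mul_nonneg (hp i j) (hx j).le) (hb0 i j))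
  refine le_trans (le_of_eq ?_) (ham.trans (le_of_eq ?_))
  · rw [← Finset.sum_neg_distrib, Real.exp_sum, ← Finset.prod_mul_distrib]
    refine Finset.prod_congr rfl fun j _ => ?_
    rcases (hp i j).lt_or_eq with h | h
    · have hb := (hint i j h).1
      have hxj := hx j
      rw [Real.rpow_def_of_pos hxj, Real.rpow_def_of_pos (by positivity), ← Real.exp_add,
        Real.log_div (by positivity) (by positivity), Real.log_div (by positivity) (by positivity),
        Real.log_mul (by positivity) (by positivity)]
      congr 1; ring
    · rw [hpz i j h.symm]; simp
  · refine Finset.sum_congr rfl fun j _ => ?_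
    rcases (hp i j).lt_or_eq with h | h
    · have hb := (hint i j h).1
      field_simp
    · rw [hpz i j h.symm, ← h]; simp
end
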